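/- Fix real numbers α, β with 0 < α < 1 and 0 < β < 1. For M₁, M₂ ≥ 2, H ≥ 1 real and Δ > 0 real, let 𝓑(M₁,M₂,H,Δ) be the number of six-tuples (m₁, m̃₁, m₂, m̃₂, h, h̃) of positive integers with m₁, m̃₁ ~ M₁, m₂, m̃₂ ~ M₂, h, h̃ ~ H, m₁ ≠ m₂, m̃₁ ≠ m̃₂, satisfying |(m₁^α − m₂^α) h^β − (m̃₁^α − m̃₂^α) h̃^β| ≤ Δ. Then for every ε > 0, 𝓑(M₁,M₂,H,Δ) ≪ (H M₁^{1+ε} + M₁^{2−α/2+ε} Δ^{1/2} H^{1−β/2}) · (H M₂^{1+ε} + M₂^{2−α/2+ε} Δ^{1/2} H^{1−β/2}), where the implied constant depends only on α, β, ε. -/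

import Mathlib

open Real Finset

/-- `𝓑(M₁,M₂,H,Δ)`: the number of six-tuples `(m₁, m̃₁, m₂, m̃₂, h, h̃)` of positive
integers with `m₁, m̃₁ ~ M₁`, `m₂, m̃₂ ~ M₂`, `h, h̃ ~ H`, `m₁ ≠ m₂`, `m̃₁ ≠ m̃₂` and
`|(m₁^α − m₂^α) h^β − (m̃₁^α − m̃₂^α) h̃^β| ≤ Δ`. -/
noncomputable def Bcount (α β M₁ M₂ H Δ : ℝ) : ℕ :=
  ((Finset.Ioc ⌊M₁⌋₊ ⌊2*M₁⌋₊ ×ˢ Finset.Ioc ⌊M₁⌋₊ ⌊2*M₁⌋₊ ×ˢ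
    Finset.Ioc ⌊M₂⌋₊ ⌊2*M₂⌋₊ ×ˢ Finset.Ioc ⌊M₂⌋₊ ⌊2*M₂⌋₊ ×ˢ
    Finset.Ioc ⌊H⌋₊ ⌊2*H⌋₊ ×ˢ Finset.Ioc ⌊H⌋₊ ⌊2*H⌋₊).filter
      (fun t : ℕ × ℕ × ℕ × ℕ × ℕ × ℕ =>
        t.1 ≠ t.2.2.1 ∧ t.2.1 ≠ t.2.2.2.1 ∧
        |((t.1 : ℝ)^α - (t.2.2.1 : ℝ)^α) * (t.2.2.2.2.1 : ℝ)^β -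
          ((t.2.1 : ℝ)^α - (t.2.2.2.1 : ℝ)^α) * (t.2.2.2.2.2 : ℝ)^β| ≤ Δ)).card

theorem rpow_mem_Icc_inv {Λ x : ℝ} (γ : ℝ) (hΛ : 1 ≤ Λ) (hx : x ∈ Set.Icc Λ⁻¹ Λ) :
    x ^ γ ∈ Set.Icc (Λ ^ |γ|)⁻¹ (Λ ^ |γ|) := by
  have h0 : 0 < Λ := by linarith
  have hx0 : 0 < x := lt_of_lt_of_le (by positivity) hx.1
  have key : ∀ y ∈ Set.Icc Λ⁻¹ Λ, ∀ s : ℝ, 0 ≤ s →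
      y ^ s ∈ Set.Icc (Λ ^ s)⁻¹ (Λ ^ s) := by
    intro y hy s hs
    have hy0 : 0 < y := lt_of_lt_of_le (by positivity) hy.1
    constructor
    · rw [← Real.inv_rpow h0.le]
      exact Real.rpow_le_rpow (by positivity) hy.1 hs
    · exact Real.rpow_le_rpow hy0.le hy.2 hs
  rcases le_total 0 γ with h | h
  · rw [abs_of_nonneg h]; exact key x hx γ h
  · rw [abs_of_nonpos h]
    have hx' : x⁻¹ ∈ Set.Icc Λ⁻¹ Λ :=
      ⟨inv_anti₀ hx0 hx.2, by rw [inv_le_comm₀ hx0 h0]; exact hx.1⟩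
    have := key x⁻¹ hx' (-γ) (by linarith)
    rwa [Real.inv_rpow hx0.le, ← Real.rpow_neg hx0.le, neg_neg] at this

theorem rpow_lipschitz (γ : ℝ) {Λ : ℝ} (hΛ : 1 ≤ Λ) :
    ∃ C : ℝ, 1 ≤ C ∧ ∀ x ∈ Set.Icc Λ⁻¹ Λ, ∀ y ∈ Set.Icc Λ⁻¹ Λ,
      |x ^ γ - y ^ γ| ≤ C * |x - y| := by
  refine ⟨1 + |γ| * Λ ^ |γ - 1|, by
    have : 0 < Λ := by linarith
    have : 0 ≤ |γ| * Λ ^ |γ - 1| := by positivity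
    linarith, ?_⟩
  intro x hx y hy
  have hΛ0 : 0 < Λ := by linarith
  have := (convex_Icc Λ⁻¹ Λ).norm_image_sub_le_of_norm_hasDerivWithin_le
    (f := fun x : ℝ => x ^ γ) (f' := fun x => γ * x ^ (γ - 1)) (C := |γ| * Λ ^ |γ - 1|)
    (fun z hz => (Real.hasDerivAt_rpow_const
      (Or.inl (lt_of_lt_of_le (by positivity) hz.1).ne')).hasDerivWithinAt)
    (fun z hz => by
      have hz0 : 0 < z := lt_of_lt_of_le (by positivity) hz.1
      rw [norm_mul, Real.norm_eq_abs, Real.norm_eq_abs, abs_of_nonneg (Real.rpow_nonneg hz0.le _)]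
      exact mul_le_mul_of_nonneg_left (rpow_mem_Icc_inv _ hΛ hz).2 (abs_nonneg _)) hy hx
  simp only [Real.norm_eq_abs] at this
  nlinarith [abs_nonneg (x - y)]

theorem rpow_taylor (γ : ℝ) {Λ : ℝ} (hΛ : 1 ≤ Λ) :
    ∃ C : ℝ, 1 ≤ C ∧ ∀ x ∈ Set.Icc Λ⁻¹ Λ, ∀ y ∈ Set.Icc Λ⁻¹ Λ,
      |x ^ γ - y ^ γ - γ * y ^ (γ - 1) * (x - y)| ≤ C * (x - y) ^ 2 := by
  obtain ⟨C, hC, h⟩ := rpow_lipschitz (γ - 1) hΛ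
  have hΛ0 : 0 < Λ := by linarith
  refine ⟨1 + |γ| * C, by
    have : 0 ≤ |γ| * C := by positivity
    linarith, ?_⟩
  intro x hx y hy
  have hsub : Set.uIcc y x ⊆ Set.Icc Λ⁻¹ Λ := Set.uIcc_subset_Icc hy hx
  have := (convex_uIcc y x).norm_image_sub_le_of_norm_hasDerivWithin_le
    (f := fun z : ℝ => z ^ γ - γ * y ^ (γ - 1) * z)
    (f' := fun z => γ * z ^ (γ - 1) - γ * y ^ (γ - 1) * 1) (C := |γ| * (C * |x - y|))
    (fun z hz => ((Real.hasDerivAt_rpow_const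
      (Or.inl (lt_of_lt_of_le (by positivity) (hsub hz).1).ne')).sub
        ((hasDerivAt_id z).const_mul _)).hasDerivWithinAt)
    (fun z hz => by
      rw [mul_one, ← mul_sub, norm_mul, Real.norm_eq_abs, Real.norm_eq_abs]
      refine mul_le_mul_of_nonneg_left ?_ (abs_nonneg _)
      refine (h z (hsub hz) y hy).trans ?_
      refine mul_le_mul_of_nonneg_left ?_ (by linarith)
      exact Set.abs_sub_left_of_mem_uIcc hz) Set.left_mem_uIcc Set.right_mem_uIcc
  simp only [Real.norm_eq_abs] at this
  have e : x ^ γ - y ^ γ - γ * y ^ (γ - 1) * (x - y) =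
    x ^ γ - γ * y ^ (γ - 1) * x - (y ^ γ - γ * y ^ (γ - 1) * y) := by ring
  rw [e]
  refine this.trans ?_
  have : |γ| * (C * |x - y|) * |x - y| = |γ| * C * (x - y) ^ 2 := by
    rw [← sq_abs (x - y)]; ring
  rw [this]
  nlinarith [sq_nonneg (x - y)]

theorem sum_zmod_stdAddChar_pi {ι : Type*} [Fintype ι] [DecidableEq ι] (P : ℕ) [NeZero P]
    (w : ι → ZMod P) :
    ∑ g : ι → ZMod P, ZMod.stdAddChar (∑ i, w i * g i) =
      if w = 0 then ((P : ℂ) ^ Fintype.card ι) else 0 := by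
  have h1 : ∀ g : ι → ZMod P, ZMod.stdAddChar (∑ i, w i * g i) =
      ∏ i, ZMod.stdAddChar (w i * g i) := fun g => by
    exact map_prod ZMod.stdAddChar.toMonoidHom (fun i => Multiplicative.ofAdd (w i * g i))
      Finset.univ
  simp_rw [h1]
  rw [← Fintype.prod_sum (fun i (z : ZMod P) => ZMod.stdAddChar (w i * z))]
  have h2 : ∀ i, ∑ z : ZMod P, ZMod.stdAddChar (w i * z) = if w i = 0 then (P : ℂ) else 0 := by
    intro i
    have := AddChar.sum_mulShift (w i) (ZMod.isPrimitive_stdAddChar P)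
    rw [ZMod.card] at this
    simp_rw [mul_comm (w i), this]
    split_ifs <;> simp
  simp_rw [h2]
  split_ifs with hw
  · simp [hw]
  · obtain ⟨i, hi⟩ := Function.ne_iff.mp hw
    exact Finset.prod_eq_zero (Finset.mem_univ i) (if_neg hi)

theorem sum_norm_sq_exp_sum {ι : Type*} [Fintype ι] [DecidableEq ι] (P : ℕ) [NeZero P]
    (A : Finset (ι → ℤ))
    (hA : ∀ v ∈ A, ∀ v' ∈ A, (fun i => (v i : ZMod P)) = (fun i => (v' i : ZMod P)) → v = v') :
    ∑ g : ι → ZMod P, ‖∑ v ∈ A, ZMod.stdAddChar (∑ i, (v i : ZMod P) * g i)‖ ^ 2 =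
      (P : ℝ) ^ Fintype.card ι * #A := by
  have h1 : ∀ g : ι → ZMod P,
      ((‖∑ v ∈ A, ZMod.stdAddChar (∑ i, (v i : ZMod P) * g i)‖ ^ 2 : ℝ) : ℂ) =
      ∑ v ∈ A, ∑ v' ∈ A, ZMod.stdAddChar (∑ i, ((v i : ZMod P) - (v' i : ZMod P)) * g i) := by
    intro g
    rw [← Complex.normSq_eq_norm_sq, ← Complex.mul_conj, map_sum, Finset.sum_mul_sum]
    refine Finset.sum_congr rfl fun v _ => Finset.sum_congr rfl fun v' _ => ?_
    rw [← AddChar.map_neg_eq_conj, ← AddChar.map_add_eq_mul]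
    congr 1
    simp only [sub_mul, Finset.sum_sub_distrib]
    ring
  have h2 : ((∑ g : ι → ZMod P, ‖∑ v ∈ A, ZMod.stdAddChar (∑ i, (v i : ZMod P) * g i)‖ ^ 2 : ℝ) : ℂ)
      = ((P : ℝ) ^ Fintype.card ι * #A : ℝ) := by
    rw [Complex.ofReal_sum]
    simp only [h1]
    rw [Finset.sum_comm]
    have h3 : ∀ v ∈ A, ∑ g : ι → ZMod P, ∑ v' ∈ A,
        ZMod.stdAddChar (∑ i, ((v i : ZMod P) - (v' i : ZMod P)) * g i) = (P : ℂ) ^ Fintype.card ι := by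
      intro v hv
      rw [Finset.sum_comm]
      have h4 : ∀ v' ∈ A, ∑ g : ι → ZMod P,
          ZMod.stdAddChar (∑ i, ((v i : ZMod P) - (v' i : ZMod P)) * g i) =
          if v' = v then (P : ℂ) ^ Fintype.card ι else 0 := by
        intro v' hv'
        rw [sum_zmod_stdAddChar_pi P (fun i => (v i : ZMod P) - (v' i : ZMod P))]
        congr 1
        rw [eq_iff_iff]
        constructor
        · intro h
          refine (hA v hv v' hv' ?_).symm
          funext i
          exact sub_eq_zero.mp (congrFun h i)
        · rintro rfl
          funext i
          simp
      rw [Finset.sum_congr rfl h4]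
      simp [hv]
    rw [Finset.sum_congr rfl h3]
    simp [mul_comm]
  exact_mod_cast h2

/-- A transference principle: if a finite set of integer points `A` pairs to within a sixth of an
integer with the points `x / P`, `x ∈ Y`, then integer points among the differences of `Y / P`
are at least as frequent as the size of `A` predicts. -/
theorem card_mul_card_le_of_pairing {ι : Type*} [Fintype ι] [DecidableEq ι] (P : ℕ) [NeZero P]
    (A Y : Finset (ι → ℤ))
    (hA : ∀ v ∈ A, ∀ v' ∈ A, (∀ i, (P : ℤ) ∣ v i - v' i) → v = v')
    (h : ∀ v ∈ A, ∀ x ∈ Y, |(∑ i, (v i : ℝ) * x i) / P| ≤ 1 / 6) :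
    ∃ D : Finset (ι → ℤ), (∀ k ∈ D, ∃ x ∈ Y, ∃ x' ∈ Y, ∀ i, x i - x' i = P * k i) ∧
      (#A * #Y : ℝ) ≤ 4 * (P : ℝ) ^ Fintype.card ι * #D := by
  classical
  set r : (ι → ℤ) → (ι → ZMod P) := fun x i => (x i : ZMod P) with hr
  have hP : (P : ℤ) ≠ 0 := by exact_mod_cast NeZero.ne P
  have hPR : (P : ℝ) ≠ 0 := by exact_mod_cast NeZero.ne P
  have hrd : ∀ x x', r x = r x' ↔ ∀ i, (P : ℤ) ∣ x i - x' i := by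
    intro x x'
    simp only [hr, funext_iff]
    refine forall_congr' fun i => ?_
    rw [← ZMod.intCast_eq_intCast_iff_dvd_sub]
    exact eq_comm
  set D : Finset (ι → ℤ) := ((Y ×ˢ Y).filter (fun q => r q.1 = r q.2)).image
    (fun q i => (q.1 i - q.2 i) / (P : ℤ)) with hD
  refine ⟨D, ?_, ?_⟩
  · intro k hk
    simp only [hD, Finset.mem_image, Finset.mem_filter, Finset.mem_product] at hk
    obtain ⟨q, ⟨⟨h1, h2⟩, h3⟩, rfl⟩ := hk
    refine ⟨q.1, h1, q.2, h2, fun i => ?_⟩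
    rw [Int.mul_ediv_cancel' ((hrd _ _).mp h3 i)]
  set f : (ι → ZMod P) → ℂ := fun g => ∑ v ∈ A, ZMod.stdAddChar (∑ i, (v i : ZMod P) * g i) with hf
  set p : (ι → ZMod P) → ℝ := fun g => #(Y.filter (fun x => r x = g)) with hp
  have hchar : ∀ v ∈ A, ∀ x ∈ Y,
      1 / 2 ≤ (ZMod.stdAddChar (∑ i, (v i : ZMod P) * r x i)).re := by
    intro v hv x hx
    have e : (∑ i, (v i : ZMod P) * r x i) = ((∑ i, v i * x i : ℤ) : ZMod P) := by
      push_cast; rfl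
    rw [e, ZMod.stdAddChar_coe]
    have e2 : 2 * (π : ℂ) * Complex.I * ((∑ i, v i * x i : ℤ) : ℂ) / P =
        ((2 * π * ((∑ i, (v i : ℝ) * x i) / P) : ℝ) : ℂ) * Complex.I := by
      push_cast; ring
    rw [e2, Complex.exp_ofReal_mul_I_re, ← Real.cos_pi_div_three, ← Real.cos_abs (2 * π * _)]
    have := h v hv x hx
    have hpi := Real.pi_pos
    refine Real.cos_le_cos_of_nonneg_of_le_pi (abs_nonneg _) (by linarith) ?_
    rw [abs_mul, abs_of_pos (by positivity)]
    nlinarith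
  have hS : (#A * #Y : ℝ) / 2 ≤ ∑ g, p g * ‖f g‖ := by
    have h1 : ∑ g, p g * ‖f g‖ = ∑ x ∈ Y, ‖f (r x)‖ := by
      rw [← Finset.sum_fiberwise_of_maps_to (s := Y) (t := Finset.univ) (g := r)
        (fun _ _ => Finset.mem_univ _)]
      refine Finset.sum_congr rfl fun g _ => ?_
      rw [Finset.sum_congr rfl (g := fun _ => ‖f g‖)
        (fun x hx => by rw [(Finset.mem_filter.mp hx).2])]
      simp [hp]
    rw [h1]
    have h2 : ∀ x ∈ Y, (#A : ℝ) / 2 ≤ ‖f (r x)‖ := by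
      intro x hx
      refine le_trans ?_ (Complex.re_le_norm _)
      rw [hf, Complex.re_sum]
      refine le_trans ?_ (Finset.sum_le_sum (fun v hv => hchar v hv x hx))
      simp [div_eq_mul_inv]
    refine le_trans ?_ (Finset.sum_le_sum h2)
    rw [Finset.sum_const, nsmul_eq_mul]
    apply le_of_eq; ring
  have hcs := Finset.sum_mul_sq_le_sq_mul_sq Finset.univ p (fun g => ‖f g‖)
  have hf2 : ∑ g, ‖f g‖ ^ 2 = (P : ℝ) ^ Fintype.card ι * #A :=
    sum_norm_sq_exp_sum P A (fun v hv v' hv' e => hA v hv v' hv' ((hrd v v').mp e))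
  have hp2 : ∑ g, p g ^ 2 ≤ #Y * #D := by
    have h1 : ∑ g, p g ^ 2 = ∑ x ∈ Y, p (r x) := by
      rw [← Finset.sum_fiberwise_of_maps_to (s := Y) (t := Finset.univ) (g := r)
        (fun _ _ => Finset.mem_univ _)]
      refine Finset.sum_congr rfl fun g _ => ?_
      rw [Finset.sum_congr rfl (g := fun _ => p g)
        (fun x hx => by rw [(Finset.mem_filter.mp hx).2])]
      rw [Finset.sum_const, nsmul_eq_mul, sq]
    rw [h1, ← nsmul_eq_mul]
    refine Finset.sum_le_card_nsmul _ _ _ fun x hx => ?_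
    suffices hle : #(Y.filter (fun x' => r x' = r x)) ≤ #D by
      exact Nat.cast_le.mpr hle
    refine Finset.card_le_card_of_injOn (fun (x' : ι → ℤ) i => (x i - x' i) / (P : ℤ)) ?_ ?_
    · intro x' hx'
      have hx' := Finset.mem_filter.mp hx'
      exact Finset.mem_image.mpr ⟨(x, x'), by simp [hx, hx'.1, hx'.2], rfl⟩
    · intro x' hx' x'' hx'' e
      have d1 := (hrd _ _).mp (Finset.mem_filter.mp hx').2
      have d2 := (hrd _ _).mp (Finset.mem_filter.mp hx'').2
      funext i
      have d1 : (P : ℤ) ∣ x i - x' i := by rw [← dvd_neg, neg_sub]; exact d1 i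
      have d2 : (P : ℤ) ∣ x i - x'' i := by rw [← dvd_neg, neg_sub]; exact d2 i
      have e := congrFun e i
      simp only at e
      have := Int.ediv_left_inj d1 d2 |>.mp e
      linarith
  rw [hf2] at hcs
  have hA0 : (0 : ℝ) ≤ #A := Nat.cast_nonneg _
  have hY0 : (0 : ℝ) ≤ #Y := Nat.cast_nonneg _
  rcases hA0.eq_or_lt with h0 | h0
  · rw [← h0]; simp; positivity
  rcases hY0.eq_or_lt with h0' | h0'
  · rw [← h0']; simp; positivity
  have hP4 : (0 : ℝ) ≤ (P : ℝ) ^ Fintype.card ι := by positivity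
  have h5 : ((#A * #Y : ℝ) / 2) ^ 2 ≤ (#Y * #D) * ((P : ℝ) ^ Fintype.card ι * #A) :=
    (pow_le_pow_left₀ (by positivity) hS 2).trans
      (hcs.trans (mul_le_mul_of_nonneg_right hp2 (by positivity)))
  have h6 : (#A * #Y : ℝ) * (#A * #Y) ≤ (#A * #Y) * (4 * (P : ℝ) ^ Fintype.card ι * #D) := by
    nlinarith
  exact le_of_mul_le_mul_left h6 (by positivity)

theorem sum_card_fiber_sq_le {ι : Type*} [DecidableEq ι] (s : Finset ι) (b : ι → ℤ)
    (T : Finset ℤ) :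
    ∑ c ∈ T, #(s.filter (fun x => b x = c)) ^ 2 ≤ #((s ×ˢ s).filter (fun p => b p.1 = b p.2)) := by
  have h := Finset.card_eq_sum_card_fiberwise (f := fun p : ι × ι => b p.1)
    (s := ((s ×ˢ s).filter (fun p => b p.1 = b p.2)).filter (fun p => b p.1 ∈ T)) (t := T)
    (fun p hp => (Finset.mem_filter.mp hp).2)
  refine le_trans (le_of_eq ?_) (h.symm.le.trans (Finset.card_filter_le _ _))
  refine Finset.sum_congr rfl fun c hc => ?_
  rw [sq, ← Finset.card_product]
  congr 1
  ext ⟨x, y⟩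
  simp only [Finset.mem_product, Finset.mem_filter]
  constructor
  · rintro ⟨⟨h1, h2⟩, h3, h4⟩
    exact ⟨⟨⟨⟨h1, h3⟩, h2.trans h4.symm⟩, h2 ▸ hc⟩, h2⟩
  · rintro ⟨⟨⟨⟨h1, h3⟩, h2⟩, _⟩, h5⟩
    exact ⟨⟨h1, h5⟩, h3, h2 ▸ h5⟩

theorem card_shift_eq_sq_le {ι κ : Type*} [DecidableEq ι] [DecidableEq κ]
    (s : Finset ι) (t : Finset κ) (b : ι → ℤ) (b' : κ → ℤ) :
    #((s ×ˢ t).filter (fun p => b p.1 = b' p.2)) ^ 2 ≤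
      #((s ×ˢ s).filter (fun p => b p.1 = b p.2)) *
        #((t ×ˢ t).filter (fun p => b' p.1 = b' p.2)) := by
  have h : #((s ×ˢ t).filter (fun p => b p.1 = b' p.2)) =
      ∑ c ∈ s.image b, #(s.filter (fun x => b x = c)) * #(t.filter (fun x => b' x = c)) := by
    rw [Finset.card_eq_sum_card_fiberwise (f := fun p : ι × κ => b p.1) (t := s.image b)
      (fun p hp => Finset.mem_image_of_mem _
        (Finset.mem_product.mp (Finset.mem_filter.mp hp).1).1)]
    refine Finset.sum_congr rfl fun c _ => ?_
    rw [← Finset.card_product]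
    congr 1
    ext ⟨x, y⟩
    simp only [Finset.mem_product, Finset.mem_filter]
    constructor
    · rintro ⟨⟨⟨h1, h3⟩, h2⟩, h5⟩
      exact ⟨⟨h1, h5⟩, h3, h2 ▸ h5⟩
    · rintro ⟨⟨h1, h2⟩, h3, h4⟩
      exact ⟨⟨⟨h1, h3⟩, h2.trans h4.symm⟩, h2⟩
  rw [h]
  exact (Finset.sum_mul_sq_le_sq_mul_sq _ _ _).trans
    (Nat.mul_le_mul (sum_card_fiber_sq_le s b _) (sum_card_fiber_sq_le t b' _))

/-- Number of pairs from `s × t` whose values under `f` and `g` are within `Δ`. -/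
noncomputable def closePairs {ι κ : Type*} (s : Finset ι) (t : Finset κ) (f : ι → ℝ) (g : κ → ℝ)
    (Δ : ℝ) : ℕ :=
  #((s ×ˢ t).filter (fun p => |f p.1 - g p.2| ≤ Δ))

theorem closePairs_le_sqrt {ι κ : Type*} [DecidableEq ι] [DecidableEq κ]
    (s : Finset ι) (t : Finset κ) (f : ι → ℝ) (g : κ → ℝ) {Δ δ : ℝ} (hΔ : 0 ≤ Δ) (hδ : 0 < δ) :
    (closePairs s t f g Δ : ℝ) ≤
      (2 * Δ / δ + 3) * √(closePairs s s f f δ * closePairs t t g g δ) := by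
  have same : ∀ x y : ℝ, ⌊x / δ⌋ = ⌊y / δ⌋ → |x - y| ≤ δ := by
    intro x y h
    have := Int.abs_sub_lt_one_of_floor_eq_floor h
    rw [← sub_div, abs_div, abs_of_pos hδ, div_lt_one hδ] at this
    exact this.le
  set D : ℤ := ⌊Δ / δ⌋ + 1 with hD
  have hD0 : 0 ≤ D := by positivity
  have hfar : ∀ x y : ℝ, |x - y| ≤ Δ → ⌊x / δ⌋ - ⌊y / δ⌋ ∈ Finset.Icc (-D) D := by
    intro x y h
    have h1 : |x / δ - y / δ| ≤ Δ / δ := by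
      rw [← sub_div, abs_div, abs_of_pos hδ]; gcongr
    rw [abs_le] at h1
    have hx1 := Int.floor_le (x / δ)
    have hx2 := Int.lt_floor_add_one (x / δ)
    have hy1 := Int.floor_le (y / δ)
    have hy2 := Int.lt_floor_add_one (y / δ)
    have hz := Int.lt_floor_add_one (Δ / δ)
    rw [Finset.mem_Icc]
    constructor
    · have : (-D : ℝ) - 1 < (⌊x / δ⌋ - ⌊y / δ⌋ : ℤ) := by rw [hD]; push_cast; linarith
      have : -D - 1 < ⌊x / δ⌋ - ⌊y / δ⌋ := by exact_mod_cast this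
      omega
    · have : ((⌊x / δ⌋ - ⌊y / δ⌋ : ℤ) : ℝ) < D + 1 := by rw [hD]; push_cast; linarith
      have : ⌊x / δ⌋ - ⌊y / δ⌋ < D + 1 := by exact_mod_cast this
      omega
  have h1 : closePairs s t f g Δ ≤ ∑ d ∈ Finset.Icc (-D) D,
      #((s ×ˢ t).filter (fun p => ⌊f p.1 / δ⌋ = ⌊g p.2 / δ⌋ + d)) := by
    rw [closePairs]
    refine le_trans (Finset.card_le_card ?_) Finset.card_biUnion_le
    intro p hp
    rw [Finset.mem_filter] at hp
    rw [Finset.mem_biUnion]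
    exact ⟨_, hfar _ _ hp.2, Finset.mem_filter.mpr ⟨hp.1, by ring⟩⟩
  have h2 : ∀ d ∈ Finset.Icc (-D) D,
      (#((s ×ˢ t).filter (fun p => ⌊f p.1 / δ⌋ = ⌊g p.2 / δ⌋ + d)) : ℝ) ≤
        √(closePairs s s f f δ * closePairs t t g g δ) := by
    intro d _
    refine Real.le_sqrt_of_sq_le ?_
    have := card_shift_eq_sq_le s t (fun x => ⌊f x / δ⌋) (fun y => ⌊g y / δ⌋ + d)
    refine le_trans (by exact_mod_cast this) (?_ : ((_ * _ : ℕ) : ℝ) ≤ _)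
    rw [Nat.cast_mul]
    gcongr
    · exact Finset.card_le_card fun p hp => by
        rw [Finset.mem_filter] at hp ⊢
        exact ⟨hp.1, same _ _ hp.2⟩
    · exact Finset.card_le_card fun p hp => by
        rw [Finset.mem_filter] at hp ⊢
        exact ⟨hp.1, same _ _ (by simpa using hp.2)⟩
  calc (closePairs s t f g Δ : ℝ) ≤ _ := Nat.cast_le.mpr h1
    _ ≤ ∑ d ∈ Finset.Icc (-D) D, √(closePairs s s f f δ * closePairs t t g g δ) := by
      rw [Nat.cast_sum]; exact Finset.sum_le_sum h2
    _ ≤ _ := by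
      rw [Finset.sum_const, nsmul_eq_mul, Int.card_Icc]
      gcongr
      have e : (((D + 1 - -D).toNat : ℕ) : ℝ) = ((D + 1 - -D : ℤ) : ℝ) := by
        exact_mod_cast Int.toNat_of_nonneg (by omega)
      rw [e]
      have := Int.floor_le (Δ / δ)
      push_cast [hD]
      rw [mul_div_assoc]
      linarith

theorem cell_geometry {α : ℝ} (hα : α ≠ 0) {Λ : ℝ} (hΛ : 1 ≤ Λ) {σ : Fin 4 → ℤ}
    (hσ : ∀ i, σ i = 1 ∨ σ i = -1) {c : ℝ} (hc : 0 ≤ c) :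
    ∃ C : ℝ, 1 ≤ C ∧ ∀ θ : ℝ, 0 < θ → θ ≤ 1 → ∀ ζ z : Fin 4 → ℝ,
      (∀ i, ζ i ∈ Set.Icc Λ⁻¹ Λ) → (∀ i, z i ∈ Set.Icc Λ⁻¹ Λ) → z 0 = ζ 0 →
      |z 1 - ζ 1| ≤ θ → |z 2 - ζ 2| ≤ θ →
      |∑ i, σ i * ζ i ^ α| ≤ c * θ ^ 2 → |∑ i, σ i * z i ^ α| ≤ c * θ ^ 2 →
      (∀ i, |z i - ζ i| ≤ C * θ) ∧ |∑ i, σ i * ζ i ^ (α - 1) * z i| ≤ C * θ ^ 2 := by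
  have hΛ0 : 0 < Λ := by linarith
  have hΛα : 1 ≤ Λ ^ |α| := Real.one_le_rpow hΛ (abs_nonneg _)
  obtain ⟨L, hL1, hL⟩ := rpow_lipschitz α hΛ
  obtain ⟨L', hL1', hL'⟩ := rpow_lipschitz α⁻¹ hΛα
  obtain ⟨T, hT1, hT⟩ := rpow_taylor α hΛ
  have hσa : ∀ i, |(σ i : ℝ)| = 1 := fun i => by rcases hσ i with h | h <;> simp [h]
  have hα' : 0 < |α| := abs_pos.mpr hα
  set K : ℝ := 1 + L' * (2 * c + 2 * L) with hK
  have hK1 : 1 ≤ K := by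
    have : 0 ≤ L' * (2 * c + 2 * L) := by positivity
    linarith
  refine ⟨K + (2 * c + |α| * c + 4 * (T * K ^ 2)) / |α|, by
    have : 0 ≤ (2 * c + |α| * c + 4 * (T * K ^ 2)) / |α| := by positivity
    linarith, ?_⟩
  intro θ hθ0 hθ1 ζ z hζ hz h0 h1 h2 hφζ hφz
  have hpos : ∀ i, 0 < ζ i := fun i => lt_of_lt_of_le (by positivity) (hζ i).1
  have hposz : ∀ i, 0 < z i := fun i => lt_of_lt_of_le (by positivity) (hz i).1
  have hθ2 : c * θ ^ 2 ≤ c * θ := by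
    apply mul_le_mul_of_nonneg_left _ hc
    nlinarith
  have h3a : |z 3 ^ α - ζ 3 ^ α| ≤ (2 * c + 2 * L) * θ := by
    have e : (σ 3 : ℝ) * (z 3 ^ α - ζ 3 ^ α) =
        (∑ i, σ i * z i ^ α) - (∑ i, σ i * ζ i ^ α) - σ 1 * (z 1 ^ α - ζ 1 ^ α)
          - σ 2 * (z 2 ^ α - ζ 2 ^ α) := by
      simp only [Fin.sum_univ_four, h0]; ring
    have e2 : |z 3 ^ α - ζ 3 ^ α| = |(σ 3 : ℝ) * (z 3 ^ α - ζ 3 ^ α)| := by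
      rw [abs_mul, hσa, one_mul]
    have b1 : |(σ 1 : ℝ) * (z 1 ^ α - ζ 1 ^ α)| ≤ L * θ := by
      rw [abs_mul, hσa, one_mul]
      exact (hL _ (hz 1) _ (hζ 1)).trans (by gcongr)
    have b2 : |(σ 2 : ℝ) * (z 2 ^ α - ζ 2 ^ α)| ≤ L * θ := by
      rw [abs_mul, hσa, one_mul]
      exact (hL _ (hz 2) _ (hζ 2)).trans (by gcongr)
    rw [e2, e]
    rw [abs_le] at *
    constructor <;> linarith [b1.1, b1.2, b2.1, b2.2]
  have h3 : |z 3 - ζ 3| ≤ L' * ((2 * c + 2 * L) * θ) := by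
    have := hL' _ (rpow_mem_Icc_inv α hΛ (hz 3)) _ (rpow_mem_Icc_inv α hΛ (hζ 3))
    rw [Real.rpow_rpow_inv (hposz 3).le hα, Real.rpow_rpow_inv (hpos 3).le hα] at this
    exact this.trans (by gcongr)
  have hall : ∀ i, |z i - ζ i| ≤ K * θ := by
    have hKθ : θ ≤ K * θ := by nlinarith
    intro i
    fin_cases i
    · simp only [Fin.zero_eta, h0, sub_self, abs_zero]; positivity
    · exact h1.trans hKθ
    · exact h2.trans hKθ
    · refine h3.trans ?_
      rw [hK]; linarith
  refine ⟨fun i => (hall i).trans ?_, ?_⟩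
  · have : 0 ≤ (2 * c + |α| * c + 4 * (T * K ^ 2)) / |α| * θ := by positivity
    linarith
  have ht : ∀ i, |(σ i : ℝ) * (z i ^ α - ζ i ^ α - α * ζ i ^ (α - 1) * (z i - ζ i))| ≤
      T * K ^ 2 * θ ^ 2 := by
    intro i
    rw [abs_mul, hσa, one_mul]
    refine (hT _ (hz i) _ (hζ i)).trans ?_
    rw [mul_assoc]
    gcongr
    rw [← sq_abs, ← mul_pow]
    exact pow_le_pow_left₀ (abs_nonneg _) (hall i) 2
  have hζα : ∀ i, ζ i ^ (α - 1) * ζ i = ζ i ^ α := fun i => by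
    rw [Real.rpow_sub_one (hpos i).ne', div_mul_cancel₀ _ (hpos i).ne']
  have e : α * (∑ i, σ i * ζ i ^ (α - 1) * z i) =
      (∑ i, σ i * z i ^ α) - (1 - α) * (∑ i, σ i * ζ i ^ α) -
        ∑ i, (σ i : ℝ) * (z i ^ α - ζ i ^ α - α * ζ i ^ (α - 1) * (z i - ζ i)) := by
    rw [Finset.mul_sum, Finset.mul_sum, ← Finset.sum_sub_distrib, ← Finset.sum_sub_distrib]
    refine Finset.sum_congr rfl fun i _ => ?_
    rw [← hζα]; ring
  have hs : |∑ i, (σ i : ℝ) * (z i ^ α - ζ i ^ α - α * ζ i ^ (α - 1) * (z i - ζ i))| ≤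
      4 * (T * K ^ 2 * θ ^ 2) := by
    refine (Finset.abs_sum_le_sum_abs _ _).trans ((Finset.sum_le_sum fun i _ => ht i).trans ?_)
    simp
  have h1α : |1 - α| ≤ 1 + |α| := by
    have := abs_sub 1 α
    rwa [abs_one] at this
  have hmain : |α| * |∑ i, σ i * ζ i ^ (α - 1) * z i| ≤
      (2 * c + |α| * c + 4 * (T * K ^ 2)) * θ ^ 2 := by
    rw [← abs_mul, e]
    refine (abs_sub _ _).trans ?_
    refine (add_le_add (abs_sub _ _) le_rfl).trans ?_
    rw [abs_mul]
    have := mul_le_mul h1α hφζ (abs_nonneg _) (by positivity)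
    linarith
  have : |∑ i, σ i * ζ i ^ (α - 1) * z i| ≤
      (2 * c + |α| * c + 4 * (T * K ^ 2)) / |α| * θ ^ 2 := by
    rw [div_mul_eq_mul_div, le_div_iff₀ hα']
    linarith
  nlinarith [sq_nonneg θ]

theorem dual_geometry {α : ℝ} (hα1 : α ≠ 1) {Λ : ℝ} (hΛ : 1 ≤ Λ) {σ : Fin 4 → ℤ}
    (hσ : ∀ i, σ i = 1 ∨ σ i = -1) {c : ℝ} (hc : 0 ≤ c) :
    ∃ η Λ' C : ℝ, 0 < η ∧ η ≤ 1 / 2 ∧ 1 ≤ Λ' ∧ 1 ≤ C ∧ ∀ R J : ℝ, 1 ≤ R → 1 ≤ J → ∀ ζ k : Fin 4 → ℝ,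
      (∀ i, ζ i ∈ Set.Icc Λ⁻¹ Λ) → |∑ i, σ i * ζ i ^ α| ≤ c / (R * J) ^ 2 →
      1 ≤ k 0 → k 0 ≤ J → (∀ i, |k i - σ i * ζ i ^ (α - 1) * k 0| ≤ η / R) →
      |∑ i, ζ i * k i| ≤ 1 / (R ^ 2 * J) →
      (∀ i, σ i * k i / k 0 ∈ Set.Icc Λ'⁻¹ Λ') ∧
      |∑ i, σ i * (σ i * k i) ^ (α / (α - 1))| ≤ C * k 0 ^ (α / (α - 1) - 2) ∧
      ∀ i, |ζ i - (σ i * k i / k 0) ^ (α - 1)⁻¹| ≤ C / (R * k 0) := by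
  have hΛ0 : 0 < Λ := by linarith
  have hα1' : α - 1 ≠ 0 := sub_ne_zero.mpr hα1
  set Λ₁ : ℝ := Λ ^ |α - 1| with hΛ₁
  have hΛ₁1 : 1 ≤ Λ₁ := Real.one_le_rpow hΛ (abs_nonneg _)
  have hΛ₂1 : 1 ≤ 2 * Λ₁ := by linarith
  set α' : ℝ := α / (α - 1) with hα'
  obtain ⟨L, hL1, hL⟩ := rpow_lipschitz (α - 1)⁻¹ hΛ₂1
  obtain ⟨T, hT1, hT⟩ := rpow_taylor α' hΛ₂1
  have hσa : ∀ i, |(σ i : ℝ)| = 1 := fun i => by rcases hσ i with h | h <;> simp [h]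
  have hσ2 : ∀ i, (σ i : ℝ) * σ i = 1 := fun i => by rcases hσ i with h | h <;> simp [h]
  set η : ℝ := 1 / (2 * Λ₁) with hη
  have hη0 : 0 < η := by positivity
  have hη1 : η ≤ 1 / 2 := by
    rw [hη]; gcongr; linarith
  set C₀ : ℝ := c + |α'| * (1 + c) + 4 * T with hC₀
  have hC₀0 : 0 ≤ C₀ := by positivity
  refine ⟨η, 2 * Λ₁, C₀ + L, hη0, hη1, hΛ₂1, by linarith, ?_⟩
  intro R J hR hJ ζ k hζ hφ hk1 hkJ hk hζk
  have hpos : ∀ i, 0 < ζ i := fun i => lt_of_lt_of_le (by positivity) (hζ i).1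
  set j := k 0 with hj
  have hj0 : 0 < j := by linarith
  have hR0 : 0 < R := by linarith
  have hJ0 : 0 < J := by linarith
  set X : Fin 4 → ℝ := fun i => σ i * k i / j with hX
  set Y : Fin 4 → ℝ := fun i => ζ i ^ (α - 1) with hY
  have hY1 : ∀ i, Y i ∈ Set.Icc Λ₁⁻¹ Λ₁ := fun i => rpow_mem_Icc_inv _ hΛ (hζ i)
  have hXY : ∀ i, |X i - Y i| ≤ η / (R * j) := by
    intro i
    have e : X i - Y i = σ i * (k i - σ i * ζ i ^ (α - 1) * j) / j := by
      rw [hX, hY]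
      simp only
      rw [mul_sub, ← mul_assoc, ← mul_assoc, hσ2]
      field_simp
    rw [e, abs_div, abs_mul, hσa, one_mul, abs_of_pos hj0, ← div_div]
    gcongr
    exact hk i
  have hRj : 1 ≤ R * j := one_le_mul_of_one_le_of_one_le hR hk1
  have hXY' : ∀ i, |X i - Y i| ≤ η := fun i =>
    (hXY i).trans (div_le_self hη0.le hRj)
  have hYm : ∀ i, Y i ∈ Set.Icc (2 * Λ₁)⁻¹ (2 * Λ₁) := fun i =>
    ⟨le_trans (by gcongr; linarith) (hY1 i).1, (hY1 i).2.trans (by linarith)⟩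
  have hXm : ∀ i, X i ∈ Set.Icc (2 * Λ₁)⁻¹ (2 * Λ₁) := by
    intro i
    have h1 := abs_le.mp (hXY' i)
    have h2 := hY1 i
    have e : Λ₁⁻¹ = 2 * η := by rw [hη]; field_simp
    have e2 : (2 * Λ₁)⁻¹ = η := by rw [hη]; field_simp
    rw [e] at h2
    rw [e2]
    exact ⟨by linarith [h2.1], by linarith [h2.2]⟩
  have hXpos : ∀ i, 0 < X i := fun i => lt_of_lt_of_le (by positivity) (hXm i).1
  have hYζ : ∀ i, Y i ^ (α - 1)⁻¹ = ζ i := fun i => Real.rpow_rpow_inv (hpos i).le hα1'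
  have hα'1 : α' - 1 = (α - 1)⁻¹ := by rw [hα']; field_simp; ring
  have hYα : ∀ i, Y i ^ α' = ζ i ^ α := fun i => by
    rw [hY]; simp only
    rw [← Real.rpow_mul (hpos i).le, hα', mul_div_cancel₀ _ hα1']
  have hζα : ∀ i, ζ i * Y i = ζ i ^ α := fun i => by
    rw [hY]; simp only
    rw [Real.rpow_sub_one (hpos i).ne', mul_div_cancel₀ _ (hpos i).ne']
  have hφ' : |∑ i, σ i * ζ i ^ α| ≤ c / j ^ 2 := by
    refine hφ.trans ?_
    gcongr
    nlinarith
  refine ⟨hXm, ?_, fun i => ?_⟩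
  · have e1 : ∀ i, (σ i * k i : ℝ) ^ α' = j ^ α' * X i ^ α' := by
      intro i
      rw [← Real.mul_rpow hj0.le (hXpos i).le]
      congr 1
      rw [hX]; simp only
      rw [mul_div_cancel₀ _ hj0.ne']
    have e2 : ∑ i, σ i * (σ i * k i : ℝ) ^ α' = j ^ α' * ∑ i, σ i * X i ^ α' := by
      rw [Finset.mul_sum]
      exact Finset.sum_congr rfl fun i _ => by rw [e1]; ring
    have e3 : ∑ i, σ i * X i ^ α' = (∑ i, σ i * ζ i ^ α) +
        α' * ((∑ i, ζ i * k i) / j - ∑ i, σ i * ζ i ^ α) +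
        ∑ i, σ i * (X i ^ α' - Y i ^ α' - α' * Y i ^ (α' - 1) * (X i - Y i)) := by
      have e4 : (∑ i, ζ i * k i) / j - ∑ i, σ i * ζ i ^ α = ∑ i, σ i * ζ i * (X i - Y i) := by
        rw [Finset.sum_div, ← Finset.sum_sub_distrib]
        refine Finset.sum_congr rfl fun i _ => ?_
        rw [mul_sub, mul_assoc _ (ζ i) (Y i), hζα]
        congr 1
        rw [hX]; simp only
        rw [← mul_div_assoc]
        congr 1
        rw [mul_assoc, mul_left_comm (ζ i), ← mul_assoc, hσ2, one_mul]
      rw [e4, Finset.mul_sum, ← Finset.sum_add_distrib, ← Finset.sum_add_distrib]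
      refine Finset.sum_congr rfl fun i _ => ?_
      rw [hYα, hα'1, hYζ]; ring
    have b1 : |(∑ i, ζ i * k i) / j - ∑ i, σ i * ζ i ^ α| ≤ (1 + c) / j ^ 2 := by
      refine (abs_sub _ _).trans ?_
      rw [add_div]
      refine add_le_add ?_ hφ'
      rw [abs_div, abs_of_pos hj0, div_le_div_iff₀ hj0 (by positivity), one_mul, sq, ← mul_assoc]
      refine mul_le_of_le_one_left hj0.le ?_
      calc |∑ i, ζ i * k i| * j ≤ 1 / (R ^ 2 * J) * J := by gcongr
        _ = 1 / R ^ 2 := by field_simp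
        _ ≤ 1 := by
          rw [div_le_one (by positivity)]
          exact one_le_pow₀ hR
    have b2 : |∑ i, σ i * (X i ^ α' - Y i ^ α' - α' * Y i ^ (α' - 1) * (X i - Y i))| ≤
        4 * T / j ^ 2 := by
      refine (Finset.abs_sum_le_sum_abs _ _).trans
        ((Finset.sum_le_sum (g := fun _ => T / j ^ 2) fun i _ => ?_).trans ?_)
      · rw [abs_mul, hσa, one_mul]
        refine (hT _ (hXm i) _ (hYm i)).trans ?_
        rw [div_eq_mul_inv]
        gcongr
        rw [← sq_abs, ← inv_pow]
        gcongr
        refine (hXY i).trans ?_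
        rw [← one_div]
        gcongr
        · linarith
        · nlinarith
      · simp; apply le_of_eq; ring
    have b3 : |∑ i, σ i * X i ^ α'| ≤ C₀ / j ^ 2 := by
      rw [e3]
      refine (abs_add_le _ _).trans ((add_le_add (abs_add_le _ _) le_rfl).trans ?_)
      rw [abs_mul]
      have := mul_le_mul_of_nonneg_left b1 (abs_nonneg α')
      have e : C₀ / j ^ 2 = c / j ^ 2 + |α'| * ((1 + c) / j ^ 2) + 4 * T / j ^ 2 := by
        rw [hC₀]; ring
      rw [e]
      linarith
    rw [e2, abs_mul, abs_of_pos (by positivity)]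
    have e5 : j ^ (α' - 2) = j ^ α' / j ^ 2 := by
      rw [Real.rpow_sub hj0]; norm_num
    rw [e5, mul_div_assoc', mul_comm]
    calc |∑ i, σ i * X i ^ α'| * j ^ α' ≤ C₀ / j ^ 2 * j ^ α' := by gcongr
      _ ≤ (C₀ + L) / j ^ 2 * j ^ α' := by gcongr; linarith
      _ = _ := by ring
  · have := hL _ (hYm i) _ (hXm i)
    rw [hYζ] at this
    refine this.trans ?_
    rw [abs_sub_comm]
    calc L * |X i - Y i| ≤ L * (η / (R * j)) := by gcongr; exact hXY i
      _ ≤ (C₀ + L) * (1 / (R * j)) := by gcongr <;> linarith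
      _ = _ := by ring

theorem exists_sheared_box (ν₁ ν₂ : ℝ) (ζ : Fin 4 → ℝ) (h3 : 0 < ζ 3) {L₀ L₁ L₂ L₃ : ℝ}
    (hL₀ : 1 ≤ L₀) (hL₁ : 1 ≤ L₁) (hL₂ : 1 ≤ L₂) (hL₃ : 1 ≤ L₃ / ζ 3) :
    ∃ Y : Finset (Fin 4 → ℤ), (∀ x ∈ Y, (0 ≤ (x 0 : ℝ) ∧ x 0 ≤ L₀) ∧
      (0 ≤ x 1 - ν₁ * x 0 ∧ x 1 - ν₁ * x 0 ≤ L₁) ∧ (0 ≤ x 2 - ν₂ * x 0 ∧ x 2 - ν₂ * x 0 ≤ L₂) ∧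
      0 ≤ ∑ i, ζ i * x i ∧ ∑ i, ζ i * x i ≤ L₃) ∧
      L₀ * L₁ * L₂ * L₃ / (16 * ζ 3) ≤ #Y := by
  classical
  set x₁ : ℕ × ℕ × ℕ × ℕ → ℤ := fun t => ⌈ν₁ * t.1⌉ + t.2.1 with hx₁
  set x₂ : ℕ × ℕ × ℕ × ℕ → ℤ := fun t => ⌈ν₂ * t.1⌉ + t.2.2.1 with hx₂
  set x₃ : ℕ × ℕ × ℕ × ℕ → ℤ := fun t =>
    ⌈-(ζ 0 * t.1 + ζ 1 * x₁ t + ζ 2 * x₂ t) / ζ 3⌉ + t.2.2.2 with hx₃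
  set g : ℕ × ℕ × ℕ × ℕ → (Fin 4 → ℤ) := fun t => ![(t.1 : ℤ), x₁ t, x₂ t, x₃ t] with hg
  have hginj : Function.Injective g := by
    rintro ⟨a, b, c, d⟩ ⟨a', b', c', d'⟩ h
    have e0 := congrFun h 0
    have e1 := congrFun h 1
    have e2 := congrFun h 2
    have e3 := congrFun h 3
    simp only [hg, hx₁, hx₂, hx₃, Matrix.cons_val] at e0 e1 e2 e3
    obtain rfl : a = a' := by exact_mod_cast e0
    obtain rfl : b = b' := by exact_mod_cast add_left_cancel e1
    obtain rfl : c = c' := by exact_mod_cast add_left_cancel e2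
    obtain rfl : d = d' := by exact_mod_cast add_left_cancel e3
    rfl
  have hceil : ∀ (s L : ℝ) (n : ℕ), 0 ≤ L → n < ⌊L⌋₊ →
      s ≤ ((⌈s⌉ + n : ℤ) : ℝ) ∧ ((⌈s⌉ + n : ℤ) : ℝ) ≤ s + L := by
    intro s L n hL hn
    have h1 := Int.le_ceil s
    have h2 := Int.ceil_lt_add_one s
    have h3 := Nat.floor_le hL
    have h4 : (n : ℝ) + 1 ≤ ⌊L⌋₊ := by exact_mod_cast hn
    have h5 : (0 : ℝ) ≤ n := Nat.cast_nonneg _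
    push_cast
    constructor <;> linarith
  have hhalf : ∀ L : ℝ, 1 ≤ L → L / 2 ≤ (⌊L⌋₊ : ℝ) := by
    intro L hL
    have h1 := Nat.lt_floor_add_one L
    have h2 : (1 : ℝ) ≤ ⌊L⌋₊ := by exact_mod_cast Nat.le_floor (by exact_mod_cast hL)
    linarith
  refine ⟨(Finset.range ⌊L₀⌋₊ ×ˢ Finset.range ⌊L₁⌋₊ ×ˢ Finset.range ⌊L₂⌋₊ ×ˢ
    Finset.range ⌊L₃ / ζ 3⌋₊).image g, ?_, ?_⟩
  · intro x hx
    rw [Finset.mem_image] at hx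
    obtain ⟨⟨a, b, c, d⟩, ht, rfl⟩ := hx
    simp only [Finset.mem_product, Finset.mem_range] at ht
    obtain ⟨ha, hb, hc, hd⟩ := ht
    have q1 := hceil (ν₁ * a) L₁ b (by linarith) hb
    have q2 := hceil (ν₂ * a) L₂ c (by linarith) hc
    have q3 := hceil (-(ζ 0 * a + ζ 1 * x₁ (a, b, c, d) + ζ 2 * x₂ (a, b, c, d)) / ζ 3)
      (L₃ / ζ 3) d (by linarith) hd
    have q0 : (a : ℝ) ≤ L₀ :=
      le_trans (by exact_mod_cast ha.le) (Nat.floor_le (by linarith))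
    have g0 : ((g (a, b, c, d) 0 : ℤ) : ℝ) = a := by simp [hg]
    have g1 : g (a, b, c, d) 1 = x₁ (a, b, c, d) := rfl
    have g2 : g (a, b, c, d) 2 = x₂ (a, b, c, d) := rfl
    have g3 : g (a, b, c, d) 3 = x₃ (a, b, c, d) := rfl
    rw [Fin.sum_univ_four, g0, g1, g2, g3]
    have q3' : -(ζ 0 * a + ζ 1 * x₁ (a, b, c, d) + ζ 2 * x₂ (a, b, c, d)) / ζ 3 ≤
      (x₃ (a, b, c, d) : ℝ) ∧ (x₃ (a, b, c, d) : ℝ) ≤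
      -(ζ 0 * a + ζ 1 * x₁ (a, b, c, d) + ζ 2 * x₂ (a, b, c, d)) / ζ 3 + L₃ / ζ 3 := q3
    rw [← add_div, div_le_iff₀ h3, le_div_iff₀ h3] at q3'
    have q1' : ν₁ * a ≤ (x₁ (a, b, c, d) : ℝ) ∧ (x₁ (a, b, c, d) : ℝ) ≤ ν₁ * a + L₁ := q1
    have q2' : ν₂ * a ≤ (x₂ (a, b, c, d) : ℝ) ∧ (x₂ (a, b, c, d) : ℝ) ≤ ν₂ * a + L₂ := q2
    refine ⟨⟨Nat.cast_nonneg _, q0⟩, ⟨?_, ?_⟩, ⟨?_, ?_⟩, ?_, ?_⟩ <;> linarith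
  · rw [Finset.card_image_of_injective _ hginj]
    simp only [Finset.card_product, Finset.card_range]
    push_cast
    have e : L₀ * L₁ * L₂ * L₃ / (16 * ζ 3) = L₀ / 2 * (L₁ / 2 * (L₂ / 2 * (L₃ / ζ 3 / 2))) := by
      field_simp; norm_num
    rw [e]
    gcongr
    · exact hhalf _ hL₀
    · exact hhalf _ hL₁
    · exact hhalf _ hL₂
    · exact hhalf _ hL₃

theorem shear_bound {Λ K R J η : ℝ} (hΛ : 1 ≤ Λ) (hK : 1 ≤ K) (hR : 1 ≤ R) (hJ : 1 ≤ J)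
    (hη : 0 ≤ η) {ζ ν y : Fin 4 → ℝ} (hζ : ∀ i, ζ i ∈ Set.Icc Λ⁻¹ Λ)
    (hν : ν 0 = 1) (hνζ : |∑ i, ν i * ζ i| ≤ K / (R * J) ^ 2)
    (h0 : 0 ≤ y 0 ∧ y 0 ≤ η * J) (h1 : 0 ≤ y 1 - ν 1 * y 0 ∧ y 1 - ν 1 * y 0 ≤ η / R)
    (h2 : 0 ≤ y 2 - ν 2 * y 0 ∧ y 2 - ν 2 * y 0 ≤ η / R)
    (h3 : 0 ≤ ∑ i, ζ i * y i ∧ ∑ i, ζ i * y i ≤ η / (R ^ 2 * J)) :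
    (∀ i, |y i - ν i * y 0| ≤ Λ * (1 + K + 2 * Λ) * η / R) ∧
      |∑ i, ζ i * (y i - ν i * y 0)| ≤ (1 + K) * η / (R ^ 2 * J) := by
  have hΛ0 : 0 < Λ := by linarith
  have hR0 : 0 < R := by linarith
  have hJ0 : 0 < J := by linarith
  have hpos : ∀ i, 0 < ζ i := fun i => lt_of_lt_of_le (by positivity) (hζ i).1
  have e1 : ∑ i, ζ i * (y i - ν i * y 0) = ∑ i, ζ i * y i - y 0 * ∑ i, ν i * ζ i := by
    rw [Finset.mul_sum, ← Finset.sum_sub_distrib]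
    exact Finset.sum_congr rfl fun i _ => by ring
  have hsum : |∑ i, ζ i * (y i - ν i * y 0)| ≤ (1 + K) * η / (R ^ 2 * J) := by
    rw [e1]
    refine (abs_sub _ _).trans ?_
    rw [abs_of_nonneg h3.1, abs_mul, abs_of_nonneg h0.1]
    have := mul_le_mul h0.2 hνζ (abs_nonneg _) (by positivity)
    have e : η * J * (K / (R * J) ^ 2) = K * η / (R ^ 2 * J) := by field_simp
    have e' : (1 + K) * η / (R ^ 2 * J) = η / (R ^ 2 * J) + K * η / (R ^ 2 * J) := by ring
    rw [e']
    linarith [h3.2]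
  refine ⟨?_, hsum⟩
  have hsum' : |∑ i, ζ i * (y i - ν i * y 0)| ≤ (1 + K) * (η / R) := by
    refine hsum.trans ?_
    rw [mul_div_assoc]
    gcongr
    nlinarith [mul_le_mul hR hJ zero_le_one (by linarith)]
  have hηR : 0 ≤ η / R := by positivity
  have hbig : η / R ≤ Λ * (1 + K + 2 * Λ) * η / R := by
    rw [mul_div_assoc]
    refine le_mul_of_one_le_left hηR ?_
    nlinarith
  have hz3 : |y 3 - ν 3 * y 0| ≤ Λ * (1 + K + 2 * Λ) * η / R := by
    have e2 : ζ 3 * (y 3 - ν 3 * y 0) = ∑ i, ζ i * (y i - ν i * y 0) -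
        ζ 1 * (y 1 - ν 1 * y 0) - ζ 2 * (y 2 - ν 2 * y 0) := by
      rw [Fin.sum_univ_four, hν]; ring
    have b1 : ζ 1 * (y 1 - ν 1 * y 0) ≤ Λ * (η / R) := by
      have := hpos 1
      exact mul_le_mul (hζ 1).2 h1.2 h1.1 hΛ0.le
    have b2 : ζ 2 * (y 2 - ν 2 * y 0) ≤ Λ * (η / R) := by
      exact mul_le_mul (hζ 2).2 h2.2 h2.1 hΛ0.le
    have c1 : 0 ≤ ζ 1 * (y 1 - ν 1 * y 0) := mul_nonneg (hpos 1).le h1.1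
    have c2 : 0 ≤ ζ 2 * (y 2 - ν 2 * y 0) := mul_nonneg (hpos 2).le h2.1
    have h4 : |ζ 3 * (y 3 - ν 3 * y 0)| ≤ (1 + K + 2 * Λ) * (η / R) := by
      rw [e2]
      rw [abs_le] at hsum' ⊢
      constructor <;> nlinarith
    rw [abs_mul, abs_of_pos (hpos 3)] at h4
    have h5 : Λ⁻¹ * |y 3 - ν 3 * y 0| ≤ (1 + K + 2 * Λ) * (η / R) :=
      (mul_le_mul_of_nonneg_right (hζ 3).1 (abs_nonneg _)).trans h4
    rw [inv_mul_le_iff₀ hΛ0] at h5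
    refine h5.trans (le_of_eq ?_)
    ring
  intro i
  fin_cases i
  · simp only [Fin.zero_eta, hν, one_mul, sub_self, abs_zero]
    positivity
  · exact (abs_of_nonneg h1.1).le.trans (h1.2.trans hbig)
  · exact (abs_of_nonneg h2.1).le.trans (h2.2.trans hbig)
  · exact hz3

theorem pairing_bound {Λ K R J η : ℝ} (hΛ : 1 ≤ Λ) (hK : 1 ≤ K) (hR : 1 ≤ R) (hJ : 1 ≤ J)
    (hη : 0 ≤ η) {ζ z ν y : Fin 4 → ℝ} (hζ : ∀ i, ζ i ∈ Set.Icc Λ⁻¹ Λ)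
    (hν : ν 0 = 1) (hνζ : |∑ i, ν i * ζ i| ≤ K / (R * J) ^ 2)
    (hνz : |∑ i, ν i * z i| ≤ K / (R * J) ^ 2) (hzζ : ∀ i, |z i - ζ i| ≤ K / (R * J))
    (h0 : 0 ≤ y 0 ∧ y 0 ≤ η * J) (h1 : 0 ≤ y 1 - ν 1 * y 0 ∧ y 1 - ν 1 * y 0 ≤ η / R)
    (h2 : 0 ≤ y 2 - ν 2 * y 0 ∧ y 2 - ν 2 * y 0 ≤ η / R)
    (h3 : 0 ≤ ∑ i, ζ i * y i ∧ ∑ i, ζ i * y i ≤ η / (R ^ 2 * J)) :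
    |∑ i, z i * y i| ≤ (K + (1 + K) + 4 * K * (Λ * (1 + K + 2 * Λ))) * (η / (R ^ 2 * J)) := by
  have hR0 : 0 < R := by linarith
  have hJ0 : 0 < J := by linarith
  have hΛ0 : 0 < Λ := by linarith
  obtain ⟨hs, hs'⟩ := shear_bound hΛ hK hR hJ hη hζ hν hνζ h0 h1 h2 h3
  have e : ∑ i, z i * y i = y 0 * ∑ i, ν i * z i + ∑ i, ζ i * (y i - ν i * y 0) +
      ∑ i, (z i - ζ i) * (y i - ν i * y 0) := by
    rw [Finset.mul_sum, ← Finset.sum_add_distrib, ← Finset.sum_add_distrib]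
    exact Finset.sum_congr rfl fun i _ => by ring
  have b1 : |y 0 * ∑ i, ν i * z i| ≤ K * (η / (R ^ 2 * J)) := by
    rw [abs_mul, abs_of_nonneg h0.1]
    refine (mul_le_mul h0.2 hνz (abs_nonneg _) (by positivity)).trans (le_of_eq ?_)
    field_simp
  have b3 : |∑ i, (z i - ζ i) * (y i - ν i * y 0)| ≤
      4 * K * (Λ * (1 + K + 2 * Λ)) * (η / (R ^ 2 * J)) := by
    refine (Finset.abs_sum_le_sum_abs _ _).trans ((Finset.sum_le_sum
      (g := fun _ => K / (R * J) * (Λ * (1 + K + 2 * Λ) * η / R)) fun i _ => ?_).trans ?_)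
    · rw [abs_mul]
      have := hs i
      have := hzζ i
      gcongr
    · simp only [Finset.sum_const, Finset.card_univ, Fintype.card_fin, nsmul_eq_mul]
      apply le_of_eq
      push_cast
      field_simp
  rw [e]
  refine (abs_add_le _ _).trans ((add_le_add (abs_add_le _ _) le_rfl).trans ?_)
  rw [mul_div_assoc] at hs'
  linarith

set_option maxHeartbeats 1000000 in
theorem cell_count {α Λ c η₂ : ℝ} (hα : α ≠ 0) (hΛ : 1 ≤ Λ) (hc : 0 ≤ c) (hη₂ : 0 < η₂)
    {σ : Fin 4 → ℤ} (hσ : ∀ i, σ i = 1 ∨ σ i = -1) (hσ0 : σ 0 = 1) :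
    ∃ C : ℝ, 1 ≤ C ∧ ∀ R J : ℝ, 1 ≤ R → 1 ≤ J → ∀ ζ : Fin 4 → ℝ, ζ 0 = 1 →
      (∀ i, ζ i ∈ Set.Icc Λ⁻¹ Λ) → |∑ i, σ i * ζ i ^ α| ≤ c / (R * J) ^ 2 →
      ∀ A : Finset (Fin 4 → ℤ), (∀ v ∈ A, 0 < v 0 ∧ (v 0 : ℝ) ≤ Λ * (R ^ 2 * J) ∧
        (∀ i, (v i / v 0 : ℝ) ∈ Set.Icc Λ⁻¹ Λ) ∧
        |∑ i, σ i * (v i / v 0 : ℝ) ^ α| ≤ c / (R * J) ^ 2 ∧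
        |(v 1 / v 0 : ℝ) - ζ 1| ≤ 1 / (R * J) ∧ |(v 2 / v 0 : ℝ) - ζ 2| ≤ 1 / (R * J)) →
      ∃ D : Finset (Fin 4 → ℤ), (∀ k ∈ D, |(k 0 : ℝ)| ≤ J ∧
        (∀ i, |k i - σ i * ζ i ^ (α - 1) * k 0| ≤ η₂ / R) ∧
        |∑ i, ζ i * k i| ≤ 1 / (R ^ 2 * J)) ∧ (#A : ℝ) ≤ C * R ^ 4 * #D := by
  obtain ⟨C₁, hC₁, hgeo⟩ := cell_geometry (α := α) hα hΛ hσ hc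
  have hΛ0 : 0 < Λ := by linarith
  set K₂ := Λ * (1 + C₁ + 2 * Λ) with hK₂
  set K₃ := C₁ + (1 + C₁) + 4 * C₁ * (Λ * (1 + C₁ + 2 * Λ)) with hK₃
  have hK₂0 : 0 < K₂ := by positivity
  have hK₃0 : 0 < K₃ := by positivity
  obtain ⟨η, hη, hη1, hηa, hηb⟩ : ∃ η : ℝ, 0 < η ∧ η ≤ 1 ∧ η ≤ η₂ / (2 * K₂) ∧
      η ≤ 1 / (6 * Λ * K₃) :=
    ⟨min 1 (min (η₂ / (2 * K₂)) (1 / (6 * Λ * K₃))), by positivity, min_le_left _ _,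
      (min_le_right _ _).trans (min_le_left _ _), (min_le_right _ _).trans (min_le_right _ _)⟩
  rw [le_div_iff₀ (by positivity)] at hηa hηb
  refine ⟨64 * Λ / η ^ 4, ?_, ?_⟩
  · rw [le_div_iff₀ (by positivity)]
    have : η ^ 4 ≤ 1 := pow_le_one₀ hη.le hη1
    linarith
  intro R J hR hJ ζ hζ0 hζ hζF A hA
  have hR0 : 0 < R := by linarith
  have hJ0 : 0 < J := by linarith
  have hRJ : 1 ≤ R * J := one_le_mul_of_one_le_of_one_le hR hJ
  have hRRJ : 1 ≤ R ^ 2 * J := one_le_mul_of_one_le_of_one_le (one_le_pow₀ hR) hJ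
  have hpos : ∀ i, 0 < ζ i := fun i => lt_of_lt_of_le (by positivity) (hζ i).1
  have hθ : c * (1 / (R * J)) ^ 2 = c / (R * J) ^ 2 := by field_simp
  have hθ' : C₁ * (1 / (R * J)) ^ 2 = C₁ / (R * J) ^ 2 := by field_simp
  have hθ'' : C₁ * (1 / (R * J)) = C₁ / (R * J) := by field_simp
  have hgeo' := hgeo (1 / (R * J)) (by positivity) (by rw [div_le_one (by positivity)]; exact hRJ)
  rw [hθ, hθ', hθ''] at hgeo'
  set ν : Fin 4 → ℝ := fun i => σ i * ζ i ^ (α - 1) with hν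
  have hν0 : ν 0 = 1 := by simp [hν, hσ0, hζ0]
  have hνζ : |∑ i, ν i * ζ i| ≤ C₁ / (R * J) ^ 2 :=
    (hgeo' ζ ζ hζ hζ rfl (by simp; positivity) (by simp; positivity) hζF hζF).2
  set P : ℕ := ⌈Λ ^ 2 * (R ^ 2 * J) / η⌉₊ + 1 with hP
  have hPlarge : Λ ^ 2 * (R ^ 2 * J) / η < P := by
    rw [hP]; push_cast
    linarith [Nat.le_ceil (Λ ^ 2 * (R ^ 2 * J) / η)]
  rw [div_lt_iff₀ hη] at hPlarge
  have hP0 : (0 : ℝ) < P := by rw [hP]; positivity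
  have : NeZero P := ⟨by rw [hP]; positivity⟩
  have hPlarge' : Λ ^ 2 * (R ^ 2 * J) < P :=
    hPlarge.trans_le (mul_le_of_le_one_right hP0.le hη1)
  have hΛΛ : Λ ≤ Λ ^ 2 := le_self_pow₀ hΛ two_ne_zero
  have hΛ2 : 1 ≤ Λ ^ 2 := one_le_pow₀ hΛ
  have hbig : Λ * (R ^ 2 * J) ≤ P * η :=
    (mul_le_mul_of_nonneg_right hΛΛ (by positivity)).trans hPlarge.le
  obtain ⟨Y, hY, hYcard⟩ := exists_sheared_box (ν 1) (ν 2) ζ (hpos 3) (L₀ := η * J * P)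
    (L₁ := η / R * P) (L₂ := η / R * P) (L₃ := η / (R ^ 2 * J) * P)
    (by nlinarith)
    (by rw [div_mul_eq_mul_div, le_div_iff₀ hR0]; nlinarith)
    (by rw [div_mul_eq_mul_div, le_div_iff₀ hR0]; nlinarith)
    (by
      rw [le_div_iff₀ (hpos 3), one_mul, div_mul_eq_mul_div, le_div_iff₀ (by positivity)]
      nlinarith [(hζ 3).2])
  have hY' : ∀ x ∈ Y, (0 ≤ (x 0 / P : ℝ) ∧ (x 0 / P : ℝ) ≤ η * J) ∧
      (0 ≤ (x 1 / P : ℝ) - ν 1 * (x 0 / P) ∧ (x 1 / P : ℝ) - ν 1 * (x 0 / P) ≤ η / R) ∧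
      (0 ≤ (x 2 / P : ℝ) - ν 2 * (x 0 / P) ∧ (x 2 / P : ℝ) - ν 2 * (x 0 / P) ≤ η / R) ∧
      0 ≤ ∑ i, ζ i * (x i / P : ℝ) ∧ ∑ i, ζ i * (x i / P : ℝ) ≤ η / (R ^ 2 * J) := by
    intro x hx
    obtain ⟨a0, a1, a2, a3⟩ := hY x hx
    have key : ∀ s L : ℝ, (0 ≤ s ∧ s ≤ L * P) → 0 ≤ s / P ∧ s / P ≤ L := fun s L h =>
      ⟨by have := h.1; positivity, by rw [div_le_iff₀ hP0]; exact h.2⟩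
    have e : ∀ j, (x j / P : ℝ) - ν j * (x 0 / P) = (x j - ν j * x 0) / P := fun j => by ring
    have e' : ∑ i, ζ i * (x i / P : ℝ) = (∑ i, ζ i * x i) / P := by
      rw [Finset.sum_div]; exact Finset.sum_congr rfl fun i _ => by ring
    rw [e, e, e']
    exact ⟨key _ _ a0, key _ _ a1, key _ _ a2, key _ _ a3⟩
  have hvpos : ∀ v ∈ A, ∀ i, 0 < (v i : ℝ) ∧ (v i : ℝ) ≤ Λ ^ 2 * (R ^ 2 * J) := by
    intro v hv i
    obtain ⟨b0, b1, b2, -⟩ := hA v hv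
    have b0' : (0 : ℝ) < v 0 := by exact_mod_cast b0
    have := b2 i
    rw [Set.mem_Icc, le_div_iff₀ b0', div_le_iff₀ b0'] at this
    exact ⟨lt_of_lt_of_le (by positivity) this.1, this.2.trans
      ((mul_le_mul_of_nonneg_left b1 hΛ0.le).trans (le_of_eq (by ring)))⟩
  have hsep : ∀ v ∈ A, ∀ v' ∈ A, (∀ i, (P : ℤ) ∣ v i - v' i) → v = v' := by
    intro v hv v' hv' hdvd
    funext i
    have h1 := hvpos v hv i
    have h2 := hvpos v' hv' i
    by_contra hne
    have h3 := Int.le_of_dvd (abs_pos.2 (sub_ne_zero.2 hne)) ((dvd_abs _ _).2 (hdvd i))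
    have h4 : (P : ℝ) ≤ |(v i : ℝ) - v' i| := by exact_mod_cast h3
    have h5 : |(v i : ℝ) - v' i| ≤ Λ ^ 2 * (R ^ 2 * J) := by
      rw [abs_le]; constructor <;> linarith [h1.1, h1.2, h2.1, h2.2]
    linarith
  have hpair : ∀ v ∈ A, ∀ x ∈ Y, |(∑ i, (v i : ℝ) * x i) / P| ≤ 1 / 6 := by
    intro v hv x hx
    obtain ⟨b0, b1, b2, b3, b4, b5⟩ := hA v hv
    have b0' : (0 : ℝ) < v 0 := by exact_mod_cast b0
    obtain ⟨a0, a1, a2, a3⟩ := hY' x hx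
    have g := hgeo' ζ (fun i => (v i / v 0 : ℝ)) hζ b2 (by simp [hζ0, b0'.ne']) b4 b5 hζF b3
    have p := pairing_bound hΛ hC₁ hR hJ hη.le (y := fun i => (x i / P : ℝ)) hζ hν0 hνζ
      g.2 g.1 a0 a1 a2 a3
    have e : (∑ i, (v i : ℝ) * x i) / P = v 0 * ∑ i, (v i / v 0 : ℝ) * (x i / P) := by
      rw [Finset.sum_div, Finset.mul_sum]
      exact Finset.sum_congr rfl fun i _ => by field_simp
    rw [e, abs_mul, abs_of_pos b0']
    refine (mul_le_mul b1 p (abs_nonneg _) (by positivity)).trans ?_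
    have e' : Λ * (R ^ 2 * J) * (K₃ * (η / (R ^ 2 * J))) = Λ * K₃ * η := by field_simp
    rw [e']
    linarith
  obtain ⟨D, hD, hcard⟩ := card_mul_card_le_of_pairing P A Y hsep hpair
  refine ⟨D, ?_, ?_⟩
  · intro k hk
    obtain ⟨x, hx, x', hx', hxx⟩ := hD k hk
    have hk' : ∀ i, (k i : ℝ) = x i / P - x' i / P := by
      intro i
      have : (x i : ℝ) - x' i = P * k i := by exact_mod_cast hxx i
      rw [← sub_div, this]; field_simp
    obtain ⟨a0, a1, a2, a3⟩ := hY' x hx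
    obtain ⟨b0, b1, b2, b3⟩ := hY' x' hx'
    refine ⟨?_, ?_, ?_⟩
    · rw [hk' 0, abs_le]
      have : η * J ≤ J := by nlinarith
      constructor <;> linarith [a0.1, a0.2, b0.1, b0.2]
    · intro i
      have s1 := (shear_bound hΛ hC₁ hR hJ hη.le (y := fun i => (x i / P : ℝ)) hζ hν0 hνζ
        a0 a1 a2 a3).1 i
      have s2 := (shear_bound hΛ hC₁ hR hJ hη.le (y := fun i => (x' i / P : ℝ)) hζ hν0 hνζ
        b0 b1 b2 b3).1 i
      rw [hk' i, hk' 0]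
      have e : (x i / P - x' i / P : ℝ) - σ i * ζ i ^ (α - 1) * (x 0 / P - x' 0 / P) =
        ((x i / P : ℝ) - ν i * (x 0 / P)) - ((x' i / P : ℝ) - ν i * (x' 0 / P)) := by
        rw [hν]; ring
      rw [e]
      refine (abs_sub _ _).trans ((add_le_add s1 s2).trans ?_)
      rw [← add_div]
      gcongr
      linarith
    · have e : ∑ i, ζ i * (k i : ℝ) = ∑ i, ζ i * (x i / P : ℝ) - ∑ i, ζ i * (x' i / P : ℝ) := by
        rw [← Finset.sum_sub_distrib]
        exact Finset.sum_congr rfl fun i _ => by rw [hk' i]; ring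
      have : η / (R ^ 2 * J) ≤ 1 / (R ^ 2 * J) := by gcongr
      rw [e, abs_le]
      constructor <;> linarith [a3.1, a3.2, b3.1, b3.2]
  · rw [Fintype.card_fin] at hcard
    have h1 : η ^ 4 * (P : ℝ) ^ 4 / (16 * Λ * R ^ 4) ≤ #Y := by
      refine le_trans ?_ hYcard
      have e : η * J * P * (η / R * P) * (η / R * P) * (η / (R ^ 2 * J) * P) / (16 * ζ 3) =
        η ^ 4 * (P : ℝ) ^ 4 / (16 * ζ 3 * R ^ 4) := by field_simp
      rw [e]
      have := hpos 3
      have := (hζ 3).2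
      gcongr
    have h2 := (mul_le_mul_of_nonneg_left h1 (Nat.cast_nonneg (#A))).trans hcard
    rw [mul_div_assoc', div_le_iff₀ (by positivity)] at h2
    have h3 : (#A : ℝ) * η ^ 4 * P ^ 4 ≤ (64 * Λ * R ^ 4 * #D) * P ^ 4 := by linarith
    have h4 := le_of_mul_le_mul_right h3 (by positivity)
    rw [div_mul_eq_mul_div, div_mul_eq_mul_div, le_div_iff₀ (by positivity)]
    exact h4

theorem cell_count_pos {α Λ c η₂ : ℝ} (hα : α ≠ 0) (hΛ : 1 ≤ Λ) (hc : 0 ≤ c) (hη₂ : 0 < η₂)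
    (hη₂1 : η₂ < 1) {σ : Fin 4 → ℤ} (hσ : ∀ i, σ i = 1 ∨ σ i = -1) (hσ0 : σ 0 = 1) :
    ∃ C : ℝ, 1 ≤ C ∧ ∀ R J : ℝ, 1 ≤ R → 1 ≤ J → ∀ ζ : Fin 4 → ℝ, ζ 0 = 1 →
      (∀ i, ζ i ∈ Set.Icc Λ⁻¹ Λ) → |∑ i, σ i * ζ i ^ α| ≤ c / (R * J) ^ 2 →
      ∀ A : Finset (Fin 4 → ℤ), (∀ v ∈ A, 0 < v 0 ∧ (v 0 : ℝ) ≤ Λ * (R ^ 2 * J) ∧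
        (∀ i, (v i / v 0 : ℝ) ∈ Set.Icc Λ⁻¹ Λ) ∧
        |∑ i, σ i * (v i / v 0 : ℝ) ^ α| ≤ c / (R * J) ^ 2 ∧
        |(v 1 / v 0 : ℝ) - ζ 1| ≤ 1 / (R * J) ∧ |(v 2 / v 0 : ℝ) - ζ 2| ≤ 1 / (R * J)) →
      ∃ D : Finset (Fin 4 → ℤ), (∀ k ∈ D, 1 ≤ (k 0 : ℝ) ∧ (k 0 : ℝ) ≤ J ∧
        (∀ i, |k i - σ i * ζ i ^ (α - 1) * k 0| ≤ η₂ / R) ∧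
        |∑ i, ζ i * k i| ≤ 1 / (R ^ 2 * J)) ∧ (#A : ℝ) ≤ C * R ^ 4 * (1 + #D) := by
  classical
  obtain ⟨C, hC, h⟩ := cell_count hα hΛ hc hη₂ hσ hσ0
  refine ⟨2 * C, by linarith, fun R J hR hJ ζ hζ0 hζ hζF A hA => ?_⟩
  obtain ⟨D, hD, hcard⟩ := h R J hR hJ ζ hζ0 hζ hζF A hA
  have hR0 : 0 < R := by linarith
  set E := D.filter (fun k => 0 < k 0) ∪ (D.filter (fun k => k 0 < 0)).image (fun k => -k) with hE
  refine ⟨E, ?_, ?_⟩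
  · intro k hk
    have key : 0 < k 0 ∧ (k ∈ D ∨ -k ∈ D) := by
      rw [hE, Finset.mem_union, Finset.mem_filter, Finset.mem_image] at hk
      rcases hk with hk | ⟨l, hl, rfl⟩
      · exact ⟨hk.2, Or.inl hk.1⟩
      · rw [Finset.mem_filter] at hl
        exact ⟨by simpa using hl.2, Or.inr (by simpa using hl.1)⟩
    obtain ⟨h0, hk⟩ := key
    have h0' : (1 : ℝ) ≤ k 0 := by exact_mod_cast h0
    have hk' : |(k 0 : ℝ)| ≤ J ∧ (∀ i, |k i - σ i * ζ i ^ (α - 1) * k 0| ≤ η₂ / R) ∧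
        |∑ i, ζ i * k i| ≤ 1 / (R ^ 2 * J) := by
      rcases hk with hk | hk
      · exact hD k hk
      · obtain ⟨a, b, d⟩ := hD _ hk
        refine ⟨by simpa using a, fun i => ?_, ?_⟩
        · have := b i
          rw [← abs_neg]
          refine le_trans (le_of_eq ?_) this
          congr 1
          simp only [Pi.neg_apply, Int.cast_neg]
          ring
        · rw [← abs_neg, ← Finset.sum_neg_distrib]
          simpa using d
    exact ⟨h0', (le_abs_self _).trans hk'.1, hk'.2⟩
  · have hsub : D ⊆ insert 0 (E ∪ E.image (fun k => -k)) := by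
      intro k hk
      rw [Finset.mem_insert, Finset.mem_union, Finset.mem_image]
      rcases lt_trichotomy (k 0) 0 with h0 | h0 | h0
      · refine Or.inr (Or.inr ⟨-k, ?_, by simp⟩)
        rw [hE, Finset.mem_union, Finset.mem_image]
        exact Or.inr ⟨k, Finset.mem_filter.2 ⟨hk, h0⟩, rfl⟩
      · refine Or.inl (funext fun i => ?_)
        have := (hD k hk).2.1 i
        rw [h0, Int.cast_zero, mul_zero, sub_zero] at this
        have h1 : |(k i : ℝ)| < 1 := lt_of_le_of_lt this (by rw [div_lt_one hR0]; linarith)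
        have h2 : |k i| < 1 := by exact_mod_cast h1
        simpa using Int.abs_lt_one_iff.1 h2
      · exact Or.inr (Or.inl (Finset.mem_union_left _ (Finset.mem_filter.2 ⟨hk, h0⟩)))
    have hle : #D ≤ 2 * (1 + #E) := by
      have h1 := Finset.card_le_card hsub
      have h2 := Finset.card_insert_le (0 : Fin 4 → ℤ) (E ∪ E.image (fun k => -k))
      have h3 := Finset.card_union_le E (E.image (fun k => -k))
      have h4 := Finset.card_image_le (s := E) (f := fun k => -k)
      omega
    have hle' : (#D : ℝ) ≤ 2 * (1 + #E) := by exact_mod_cast hle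
    calc (#A : ℝ) ≤ C * R ^ 4 * #D := hcard
      _ ≤ C * R ^ 4 * (2 * (1 + #E)) := by gcongr
      _ = 2 * C * R ^ 4 * (1 + #E) := by ring

theorem card_le_of_mem_Icc {s : Finset ℤ} {a b : ℝ} (hab : 0 ≤ b - a)
    (h : ∀ n ∈ s, a ≤ n ∧ (n : ℝ) ≤ b) : (#s : ℝ) ≤ b - a + 1 := by
  have hsub : s ⊆ Finset.Icc ⌈a⌉ ⌊b⌋ := fun n hn =>
    Finset.mem_Icc.2 ⟨Int.ceil_le.2 (h n hn).1, Int.le_floor.2 (h n hn).2⟩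
  have h1 : (#s : ℝ) ≤ ((⌊b⌋ + 1 - ⌈a⌉).toNat : ℝ) := by
    exact_mod_cast (Finset.card_le_card hsub).trans (Int.card_Icc _ _).le
  refine h1.trans ?_
  rcases le_total 0 (⌊b⌋ + 1 - ⌈a⌉) with h0 | h0
  · have : ((⌊b⌋ + 1 - ⌈a⌉).toNat : ℝ) = ((⌊b⌋ + 1 - ⌈a⌉ : ℤ) : ℝ) := by
      exact_mod_cast congrArg (Int.cast : ℤ → ℝ) (Int.toNat_of_nonneg h0)
    rw [this]
    push_cast
    linarith [Int.floor_le b, Int.le_ceil a]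
  · rw [Int.toNat_of_nonpos h0]
    push_cast
    linarith

theorem card_cells_near_le {I : Finset (ℤ × ℤ)} {θ r a₁ a₂ : ℝ} {p : ℤ × ℤ → ℝ × ℝ} (hθ : 0 < θ)
    (hr : θ ≤ r) (hp : ∀ c ∈ I, ⌊(p c).1 / θ⌋ = c.1 ∧ ⌊(p c).2 / θ⌋ = c.2)
    (h : ∀ c ∈ I, |(p c).1 - a₁| ≤ r ∧ |(p c).2 - a₂| ≤ r) : (#I : ℝ) ≤ 16 * (r / θ) ^ 2 := by
  classical
  have hrθ : 1 ≤ r / θ := by rwa [le_div_iff₀ hθ, one_mul]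
  have key : ∀ (n : ℤ) (x a : ℝ), ⌊x / θ⌋ = n → |x - a| ≤ r →
      a / θ - r / θ - 1 ≤ n ∧ (n : ℝ) ≤ a / θ + r / θ := by
    rintro n x a rfl hx
    rw [abs_le] at hx
    have h1 := Int.floor_le (x / θ)
    have h2 := Int.lt_floor_add_one (x / θ)
    have h3 : x / θ ≤ a / θ + r / θ := by rw [← add_div]; gcongr; linarith
    have h4 : a / θ - r / θ ≤ x / θ := by rw [← sub_div]; gcongr; linarith
    constructor <;> linarith
  have h1 : (#(I.image Prod.fst) : ℝ) ≤ 4 * (r / θ) := by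
    refine (card_le_of_mem_Icc (a := a₁ / θ - r / θ - 1) (b := a₁ / θ + r / θ) (by linarith)
      fun n hn => ?_).trans (by linarith)
    obtain ⟨c, hc, rfl⟩ := Finset.mem_image.1 hn
    exact key _ _ _ (hp c hc).1 (h c hc).1
  have h2 : (#(I.image Prod.snd) : ℝ) ≤ 4 * (r / θ) := by
    refine (card_le_of_mem_Icc (a := a₂ / θ - r / θ - 1) (b := a₂ / θ + r / θ) (by linarith)
      fun n hn => ?_).trans (by linarith)
    obtain ⟨c, hc, rfl⟩ := Finset.mem_image.1 hn
    exact key _ _ _ (hp c hc).2 (h c hc).2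
  have h3 : (#I : ℝ) ≤ #(I.image Prod.fst) * #(I.image Prod.snd) := by
    exact_mod_cast (Finset.card_le_card (Finset.subset_product)).trans
      (Finset.card_product _ _).le
  calc (#I : ℝ) ≤ _ := h3
    _ ≤ 4 * (r / θ) * (4 * (r / θ)) := by gcongr
    _ = 16 * (r / θ) ^ 2 := by ring

/-- Integer points `v` of size about `M` with `|∑ σᵢ vᵢ^α| ≪ M ^ (α - 2)` number
`≪ M ^ (2 + β)`. -/
def EnergyBound (σ : Fin 4 → ℤ) (α β : ℝ) : Prop :=
  ∀ Λ c : ℝ, 1 ≤ Λ → 0 ≤ c → ∃ C : ℝ, 1 ≤ C ∧ ∀ M : ℝ, 1 ≤ M → ∀ s : Finset (Fin 4 → ℤ),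
    (∀ v ∈ s, (∀ i, M / Λ ≤ v i ∧ (v i : ℝ) ≤ Λ * M) ∧
      |∑ i, σ i * (v i : ℝ) ^ α| ≤ c * M ^ (α - 2)) → (#s : ℝ) ≤ C * M ^ (2 + β)

theorem sum_two_pow_rpow_le {β J : ℝ} (hβ : 0 < β) {n : ℕ} (hn : (2 : ℝ) ^ n ≤ J) :
    ∑ i ∈ Finset.range (n + 1), ((2 : ℝ) ^ i) ^ β ≤ 2 ^ β / (2 ^ β - 1) * J ^ β := by
  have h1 : (1 : ℝ) < 2 ^ β := Real.one_lt_rpow one_lt_two hβ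
  have e : ∀ i : ℕ, ((2 : ℝ) ^ i) ^ β = (2 ^ β) ^ i := fun i => by
    rw [← Real.rpow_natCast, ← Real.rpow_mul zero_le_two, mul_comm, Real.rpow_mul zero_le_two,
      Real.rpow_natCast]
  have h2 : ((2 : ℝ) ^ β) ^ n ≤ J ^ β := by
    rw [← e]; exact Real.rpow_le_rpow (by positivity) hn hβ.le
  have h3 : (0 : ℝ) < 2 ^ β - 1 := by linarith
  simp only [e]
  rw [geom_sum_eq h1.ne', pow_succ, div_mul_eq_mul_div]
  gcongr
  nlinarith

theorem EnergyBound.sum_div_sq_le {σ : Fin 4 → ℤ} (hσ : ∀ i, σ i = 1 ∨ σ i = -1) {α β : ℝ}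
    (hβ : 0 < β) (h : EnergyBound σ α β) {Λ c : ℝ} (hΛ : 1 ≤ Λ) (hc : 0 ≤ c) :
    ∃ C : ℝ, 1 ≤ C ∧ ∀ J : ℝ, 1 ≤ J → ∀ S : Finset (Fin 4 → ℤ),
      (∀ k ∈ S, 1 ≤ (k 0 : ℝ) ∧ (k 0 : ℝ) ≤ J ∧
        (∀ i, (σ i * k i / k 0 : ℝ) ∈ Set.Icc Λ⁻¹ Λ) ∧
        |∑ i, σ i * (σ i * k i : ℝ) ^ α| ≤ c * (k 0 : ℝ) ^ (α - 2)) →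
      ∑ k ∈ S, (J / k 0) ^ 2 ≤ C * J ^ (2 + β) := by
  classical
  have hΛ0 : 0 < Λ := by linarith
  obtain ⟨C, hC, hE⟩ := h (2 * Λ) (c * 2 ^ |α - 2|) (by linarith) (by positivity)
  have h2β : (1 : ℝ) < 2 ^ β := Real.one_lt_rpow one_lt_two hβ
  have h2β' : (0 : ℝ) < 2 ^ β - 1 := by linarith
  refine ⟨C * (2 ^ β / (2 ^ β - 1)), ?_, ?_⟩
  · refine one_le_mul_of_one_le_of_one_le hC ?_
    rw [le_div_iff₀ h2β']; linarith
  intro J hJ S hS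
  have hJ0 : 0 < J := by linarith
  set f : (Fin 4 → ℤ) → ℕ := fun k => Nat.log 2 (k 0).toNat with hf
  set n := Nat.log 2 ⌊J⌋₊ with hn
  have hcast : ∀ k ∈ S, (((k 0).toNat : ℕ) : ℝ) = k 0 := by
    intro k hk
    have h0 : (1 : ℝ) ≤ k 0 := (hS k hk).1
    have h1 : 0 ≤ k 0 := by
      have : (1 : ℤ) ≤ k 0 := by exact_mod_cast h0
      omega
    exact_mod_cast congrArg (Int.cast : ℤ → ℝ) (Int.toNat_of_nonneg h1)
  have hlog : ∀ k ∈ S, (2 : ℝ) ^ f k ≤ k 0 ∧ (k 0 : ℝ) ≤ 2 * 2 ^ f k := by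
    intro k hk
    have h0 : (k 0).toNat ≠ 0 := by
      have := hcast k hk
      have h1 := (hS k hk).1
      intro h0
      rw [h0, Nat.cast_zero] at this
      linarith
    rw [← hcast k hk]
    constructor
    · exact_mod_cast Nat.pow_log_le_self 2 h0
    · have := (Nat.lt_pow_succ_log_self one_lt_two (k 0).toNat).le
      rw [pow_succ, mul_comm] at this
      exact_mod_cast this
  have hmaps : ∀ k ∈ S, f k ∈ Finset.range (n + 1) := by
    intro k hk
    rw [Finset.mem_range, Nat.lt_succ_iff]
    refine Nat.log_mono_right (Nat.le_floor ?_)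
    rw [hcast k hk]
    exact (hS k hk).2.1
  rw [← Finset.sum_fiberwise_of_maps_to hmaps]
  have hfib : ∀ i ∈ Finset.range (n + 1), ∑ k ∈ S with f k = i, (J / (k 0 : ℝ)) ^ 2 ≤
      C * J ^ 2 * ((2 : ℝ) ^ i) ^ β := by
    intro i _
    have hM : (1 : ℝ) ≤ 2 ^ i := one_le_pow₀ one_le_two
    have hM0 : (0 : ℝ) < 2 ^ i := by positivity
    have hinj : Function.Injective (fun (k : Fin 4 → ℤ) (j : Fin 4) => σ j * k j) := by
      intro k k' hkk
      funext j
      have := congrFun hkk j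
      rcases hσ j with hj | hj <;> simpa [hj] using this
    have hcard := hE (2 ^ i) hM ((S.filter (fun k => f k = i)).image
      (fun k j => σ j * k j)) (by
        intro v hv
        obtain ⟨k, hk, rfl⟩ := Finset.mem_image.1 hv
        rw [Finset.mem_filter] at hk
        obtain ⟨hkS, rfl⟩ := hk
        obtain ⟨a, b, d, e⟩ := hS k hkS
        obtain ⟨l1, l2⟩ := hlog k hkS
        have hk0 : (0 : ℝ) < k 0 := by linarith
        push_cast
        refine ⟨fun j => ?_, ?_⟩
        · have := d j
          rw [Set.mem_Icc, le_div_iff₀ hk0, div_le_iff₀ hk0] at this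
          constructor
          · refine le_trans ?_ this.1
            rw [inv_mul_eq_div]
            gcongr
            · linarith
          · refine this.2.trans ?_
            calc Λ * (k 0 : ℝ) ≤ Λ * (2 * 2 ^ f k) := by gcongr
              _ = 2 * Λ * 2 ^ f k := by ring
        · refine e.trans ?_
          have hx : (k 0 / 2 ^ f k : ℝ) ∈ Set.Icc (2 : ℝ)⁻¹ 2 := by
            rw [Set.mem_Icc, le_div_iff₀ hM0, div_le_iff₀ hM0]
            constructor <;> linarith
          have hy := (rpow_mem_Icc_inv (α - 2) one_le_two hx).2
          rw [Real.div_rpow hk0.le hM0.le, div_le_iff₀ (by positivity)] at hy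
          rw [mul_assoc]
          gcongr)
    rw [Finset.card_image_of_injective _ hinj] at hcard
    have hterm : ∀ k ∈ S.filter (fun k => f k = i), (J / (k 0 : ℝ)) ^ 2 ≤ (J / 2 ^ i) ^ 2 := by
      intro k hk
      rw [Finset.mem_filter] at hk
      have := (hlog k hk.1).1
      rw [hk.2] at this
      have : (0 : ℝ) < k 0 := by linarith
      gcongr
    refine (Finset.sum_le_card_nsmul _ _ _ hterm).trans ?_
    rw [nsmul_eq_mul]
    calc (#(S.filter (fun k => f k = i)) : ℝ) * (J / 2 ^ i) ^ 2
        ≤ C * (2 ^ i) ^ (2 + β) * (J / 2 ^ i) ^ 2 := by gcongr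
      _ = C * J ^ 2 * ((2 : ℝ) ^ i) ^ β := by
        rw [Real.rpow_add hM0, Real.rpow_two]
        field_simp
  refine (Finset.sum_le_sum hfib).trans ?_
  rw [← Finset.mul_sum]
  have h2n : (2 : ℝ) ^ n ≤ J := by
    have : (2 : ℕ) ^ n ≤ ⌊J⌋₊ := Nat.pow_log_le_self 2 (Nat.floor_pos.2 hJ).ne'
    exact le_trans (by exact_mod_cast this) (Nat.floor_le hJ0.le)
  refine (mul_le_mul_of_nonneg_left (sum_two_pow_rpow_le hβ h2n) (by positivity)).trans ?_
  rw [Real.rpow_add hJ0, Real.rpow_two]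
  apply le_of_eq
  ring

theorem EnergyBound.card_le_of_dual {σ : Fin 4 → ℤ} (hσ : ∀ i, σ i = 1 ∨ σ i = -1)
    (hσ0 : σ 0 = 1) {α β : ℝ} (hα : α ≠ 0) (hα1 : α ≠ 1) (hβ : 0 < β)
    (h : EnergyBound σ (α / (α - 1)) β) {Λ c : ℝ} (hΛ : 1 ≤ Λ) (hc : 0 ≤ c) :
    ∃ C : ℝ, 1 ≤ C ∧ ∀ R J : ℝ, 1 ≤ R → 1 ≤ J → ∀ s : Finset (Fin 4 → ℤ),
      (∀ v ∈ s, 0 < v 0 ∧ (v 0 : ℝ) ≤ Λ * (R ^ 2 * J) ∧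
        (∀ i, (v i / v 0 : ℝ) ∈ Set.Icc Λ⁻¹ Λ) ∧
        |∑ i, σ i * (v i / v 0 : ℝ) ^ α| ≤ c / (R * J) ^ 2) →
      (#s : ℝ) ≤ C * R ^ 4 * ((R * J) ^ 2 + J ^ (2 + β)) := by
  classical
  obtain ⟨η, Λ', C₁, hη0, hη1, hΛ', hC₁, hdual⟩ := dual_geometry hα1 hΛ hσ hc
  obtain ⟨C₂, hC₂, hcell⟩ := cell_count_pos hα hΛ hc hη0 (by linarith) hσ hσ0
  obtain ⟨C₃, hC₃, hsum⟩ := h.sum_div_sq_le hσ hβ hΛ' (zero_le_one.trans hC₁)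
  have hΛ2 : 1 ≤ Λ ^ 2 := one_le_pow₀ hΛ
  refine ⟨C₂ * (16 * Λ ^ 2 + 16 * C₁ ^ 2 * C₃),
    one_le_mul_of_one_le_of_one_le hC₂ (by
      have : 0 ≤ 16 * C₁ ^ 2 * C₃ := by positivity
      linarith), ?_⟩
  intro R J hR hJ s hs
  have hR0 : 0 < R := by linarith
  have hJ0 : 0 < J := by linarith
  have hRJ : 1 ≤ R * J := one_le_mul_of_one_le_of_one_le hR hJ
  set θ : ℝ := 1 / (R * J) with hθ
  have hθ0 : 0 < θ := by positivity
  have hθ1 : θ ≤ 1 := by rw [hθ, div_le_one (by positivity)]; exact hRJ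
  set p : (Fin 4 → ℤ) → ℤ × ℤ := fun v =>
    (⌊(v 1 / v 0 : ℝ) / θ⌋, ⌊(v 2 / v 0 : ℝ) / θ⌋) with hp
  set I := s.image p with hI
  have hrep' : ∀ c ∈ I, ∃ v ∈ s, p v = c := fun c hc => Finset.mem_image.1 hc
  choose! rep hreps hrepp using hrep'
  set ζ : ℤ × ℤ → Fin 4 → ℝ := fun c i => (rep c i / rep c 0 : ℝ) with hζ
  have hnear : ∀ x y : ℝ, ⌊x / θ⌋ = ⌊y / θ⌋ → |x - y| ≤ θ := by
    intro x y hxy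
    have := Int.abs_sub_lt_one_of_floor_eq_floor hxy
    rw [← sub_div, abs_div, abs_of_pos hθ0, div_lt_one hθ0] at this
    exact this.le
  have hD' : ∀ c ∈ I, ∃ D : Finset (Fin 4 → ℤ), (∀ k ∈ D, 1 ≤ (k 0 : ℝ) ∧ (k 0 : ℝ) ≤ J ∧
      (∀ i, |k i - σ i * ζ c i ^ (α - 1) * k 0| ≤ η / R) ∧
      |∑ i, ζ c i * k i| ≤ 1 / (R ^ 2 * J)) ∧
      (#(s.filter (fun v => p v = c)) : ℝ) ≤ C₂ * R ^ 4 * (1 + #D) := by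
    intro c hcI
    obtain ⟨a0, a1, a2, a3⟩ := hs _ (hreps c hcI)
    have a0' : (rep c 0 : ℝ) ≠ 0 := by exact_mod_cast a0.ne'
    refine hcell R J hR hJ (ζ c) (div_self a0') a2 a3 _ fun v hv => ?_
    rw [Finset.mem_filter] at hv
    obtain ⟨b0, b1, b2, b3⟩ := hs _ hv.1
    have e : p v = p (rep c) := hv.2.trans (hrepp c hcI).symm
    exact ⟨b0, b1, b2, b3, hnear _ _ (congrArg Prod.fst e), hnear _ _ (congrArg Prod.snd e)⟩
  choose! D hD hDcard using hD'
  have hfloor : ∀ c ∈ I, ⌊ζ c 1 / θ⌋ = c.1 ∧ ⌊ζ c 2 / θ⌋ = c.2 := fun c hcI =>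
    ⟨congrArg Prod.fst (hrepp c hcI), congrArg Prod.snd (hrepp c hcI)⟩
  have hcells : (#I : ℝ) ≤ 16 * Λ ^ 2 * (R * J) ^ 2 := by
    refine (card_cells_near_le (r := Λ) (a₁ := 0) (a₂ := 0)
      (p := fun c => (ζ c 1, ζ c 2)) hθ0 (hθ1.trans hΛ) hfloor fun c hcI => ?_).trans (le_of_eq ?_)
    · have key : ∀ i, |ζ c i - 0| ≤ Λ := fun i => by
        have h1 := (hs _ (hreps c hcI)).2.2.1 i
        have h2 : 0 < ζ c i := lt_of_lt_of_le (by positivity) h1.1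
        rw [sub_zero, abs_of_pos h2]
        exact h1.2
      exact ⟨key 1, key 2⟩
    · rw [hθ]; field_simp
  set S := I.biUnion D with hS
  have hgeo : ∀ c ∈ I, ∀ k ∈ D c, (∀ i, (σ i * k i / k 0 : ℝ) ∈ Set.Icc Λ'⁻¹ Λ') ∧
      |∑ i, σ i * (σ i * k i : ℝ) ^ (α / (α - 1))| ≤ C₁ * (k 0 : ℝ) ^ (α / (α - 1) - 2) ∧
      ∀ i, |ζ c i - (σ i * k i / k 0 : ℝ) ^ (α - 1)⁻¹| ≤ C₁ / (R * k 0) := by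
    intro c hcI k hk
    obtain ⟨a, b, d, e⟩ := hD c hcI k hk
    obtain ⟨a0, a1, a2, a3⟩ := hs _ (hreps c hcI)
    exact hdual R J hR hJ (ζ c) (fun i => (k i : ℝ)) a2 a3 a b d e
  have hSsum : ∑ k ∈ S, (J / (k 0 : ℝ)) ^ 2 ≤ C₃ * J ^ (2 + β) := by
    refine hsum J hJ S fun k hk => ?_
    obtain ⟨c, hcI, hkc⟩ := Finset.mem_biUnion.1 hk
    have g := hgeo c hcI k hkc
    have d := hD c hcI k hkc
    exact ⟨d.1, d.2.1, g.1, g.2.1⟩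
  have hmult : ∀ k ∈ S, (#(I.filter (fun c => k ∈ D c)) : ℝ) ≤
      16 * C₁ ^ 2 * (J / (k 0 : ℝ)) ^ 2 := by
    intro k hk
    obtain ⟨c₀, hc₀, hkc₀⟩ := Finset.mem_biUnion.1 hk
    obtain ⟨hk1, hkJ, -⟩ := hD c₀ hc₀ k hkc₀
    have hk0 : (0 : ℝ) < k 0 := by linarith
    refine (card_cells_near_le (r := C₁ / (R * k 0))
      (a₁ := (σ 1 * k 1 / k 0 : ℝ) ^ (α - 1)⁻¹) (a₂ := (σ 2 * k 2 / k 0 : ℝ) ^ (α - 1)⁻¹)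
      (p := fun c => (ζ c 1, ζ c 2)) hθ0 ?_ (fun c hcI => hfloor c (Finset.mem_filter.1 hcI).1)
      fun c hcI => ?_).trans (le_of_eq ?_)
    · rw [hθ]; gcongr
    · rw [Finset.mem_filter] at hcI
      have g := (hgeo c hcI.1 k hcI.2).2.2
      exact ⟨g 1, g 2⟩
    · rw [hθ]; field_simp
  have hDsum : ∑ c ∈ I, (#(D c) : ℝ) ≤ 16 * C₁ ^ 2 * C₃ * J ^ (2 + β) := by
    have e1 : ∑ c ∈ I, #(D c) ≤ ∑ k ∈ S, #(I.filter (fun c => k ∈ D c)) := by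
      refine le_trans ?_ (Finset.sum_card_bipartiteAbove_eq_sum_card_bipartiteBelow
        (s := I) (t := S) (fun c k => k ∈ D c)).le
      refine Finset.sum_le_sum fun c hcI => Finset.card_le_card fun k hk => ?_
      exact Finset.mem_filter.2 ⟨Finset.mem_biUnion.2 ⟨c, hcI, hk⟩, hk⟩
    have e2 : ∑ c ∈ I, (#(D c) : ℝ) ≤ ∑ k ∈ S, (#(I.filter (fun c => k ∈ D c)) : ℝ) := by
      exact_mod_cast e1
    refine e2.trans ((Finset.sum_le_sum hmult).trans ?_)
    rw [← Finset.mul_sum]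
    refine (mul_le_mul_of_nonneg_left hSsum (by positivity)).trans (le_of_eq ?_)
    ring
  have hJβ : 0 < J ^ (2 + β) := by positivity
  calc (#s : ℝ) = ∑ c ∈ I, (#(s.filter (fun v => p v = c)) : ℝ) := by
        exact_mod_cast Finset.card_eq_sum_card_image p s
    _ ≤ ∑ c ∈ I, C₂ * R ^ 4 * (1 + #(D c)) := Finset.sum_le_sum hDcard
    _ = C₂ * R ^ 4 * (#I + ∑ c ∈ I, (#(D c) : ℝ)) := by
        rw [← Finset.mul_sum, Finset.sum_add_distrib, Finset.sum_const, nsmul_eq_mul, mul_one]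
    _ ≤ C₂ * R ^ 4 * (16 * Λ ^ 2 * (R * J) ^ 2 + 16 * C₁ ^ 2 * C₃ * J ^ (2 + β)) := by gcongr
    _ ≤ C₂ * R ^ 4 * ((16 * Λ ^ 2 + 16 * C₁ ^ 2 * C₃) * ((R * J) ^ 2 + J ^ (2 + β))) := by
        gcongr
        have x1 : 0 ≤ 16 * Λ ^ 2 * J ^ (2 + β) := by positivity
        have x2 : 0 ≤ 16 * C₁ ^ 2 * C₃ * (R * J) ^ 2 := by positivity
        linarith
    _ = C₂ * (16 * Λ ^ 2 + 16 * C₁ ^ 2 * C₃) * R ^ 4 * ((R * J) ^ 2 + J ^ (2 + β)) := by ring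

theorem EnergyBound.of_dual {σ : Fin 4 → ℤ} (hσ : ∀ i, σ i = 1 ∨ σ i = -1)
    (hσ0 : σ 0 = 1) {α β : ℝ} (hα : α ≠ 0) (hα1 : α ≠ 1) (hβ : 0 < β)
    (h : EnergyBound σ (α / (α - 1)) β) : EnergyBound σ α (β / (1 + β)) := by
  intro Λ c hΛ hc
  have hΛ0 : 0 < Λ := by linarith
  have hβ1 : 0 < 1 + β := by linarith
  have hΛ2 : Λ ≤ Λ ^ 2 := le_self_pow₀ hΛ two_ne_zero
  obtain ⟨C, hC, hcard⟩ := h.card_le_of_dual hσ hσ0 hα hα1 hβ (Λ := Λ ^ 2)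
    (c := c * Λ ^ |α|) (one_le_pow₀ hΛ) (by positivity)
  refine ⟨2 * C, by linarith, fun M hM s hs => ?_⟩
  have hM0 : 0 < M := by linarith
  have hlog : ∀ x y : ℝ, M ^ x * M ^ y = M ^ (x + y) := fun x y => (Real.rpow_add hM0 x y).symm
  have hMn : ∀ (n : ℕ) (x : ℝ), (M ^ x) ^ n = M ^ (x * n) := fun n x => by
    rw [Real.rpow_mul hM0.le, Real.rpow_natCast]
  set R := M ^ ((1 - 1 / (1 + β)) / 2) with hR
  set J := M ^ (1 / (1 + β)) with hJ
  have h1β : 1 / (1 + β) ≤ 1 := by rw [div_le_one hβ1]; linarith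
  have hR1 : 1 ≤ R := Real.one_le_rpow hM (by linarith)
  have hJ1 : 1 ≤ J := Real.one_le_rpow hM (by positivity)
  have hRRJ : R ^ 2 * J = M := by
    rw [hR, hJ, hMn, hlog]
    conv_rhs => rw [← Real.rpow_one M]
    congr 1; push_cast; ring
  have hJM : J ≤ M := by
    conv_rhs => rw [← Real.rpow_one M]
    exact Real.rpow_le_rpow_of_exponent_le hM h1β
  have hRJM : (R * J) ^ 2 ≤ M ^ 2 := by
    have : (R * J) ^ 2 = M * J := by rw [← hRRJ]; ring
    rw [this, pow_two]
    gcongr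
  have key := hcard R J hR1 hJ1 s fun v hv => ?_
  · have e1 : R ^ 4 * (R * J) ^ 2 = M ^ (2 + β / (1 + β)) := by
      rw [mul_pow, hR, hJ]
      simp only [hMn, hlog]
      congr 1; push_cast; field_simp; ring
    have e2 : R ^ 4 * J ^ (2 + β) = M ^ (2 + β / (1 + β)) := by
      rw [hR, hJ, ← Real.rpow_mul hM0.le]
      simp only [hMn, hlog]
      congr 1; push_cast; field_simp; ring
    rw [mul_assoc, mul_add, e1, e2] at key
    linarith
  · obtain ⟨a, b⟩ := hs v hv
    have hpos : ∀ i, (0 : ℝ) < v i := fun i => lt_of_lt_of_le (by positivity) (a i).1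
    have h0 := hpos 0
    have hI : ∀ i, Λ⁻¹ * M ≤ v i ∧ (v i : ℝ) ≤ Λ * M := fun i => by
      rw [inv_mul_eq_div]; exact a i
    refine ⟨by exact_mod_cast h0, ?_, ?_, ?_⟩
    · rw [hRRJ]
      exact (a 0).2.trans (by gcongr)
    · intro i
      rw [Set.mem_Icc, le_div_iff₀ h0, div_le_iff₀ h0]
      constructor
      · refine le_trans ?_ (hI i).1
        rw [inv_mul_le_iff₀ (by positivity)]
        refine (a 0).2.trans (le_of_eq ?_)
        field_simp
      · refine (a i).2.trans ?_
        have := mul_le_mul_of_nonneg_left (hI 0).1 (show 0 ≤ Λ ^ 2 by positivity)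
        refine le_trans (le_of_eq ?_) this
        field_simp
    · have e : ∑ i, σ i * (v i / v 0 : ℝ) ^ α = (∑ i, σ i * (v i : ℝ) ^ α) / (v 0 : ℝ) ^ α := by
        rw [Finset.sum_div]
        refine Finset.sum_congr rfl fun i _ => ?_
        rw [Real.div_rpow (hpos i).le h0.le, mul_div_assoc]
      have hq : (M / v 0 : ℝ) ∈ Set.Icc Λ⁻¹ Λ := by
        rw [Set.mem_Icc, le_div_iff₀ h0, div_le_iff₀ h0, inv_mul_le_iff₀ hΛ0, mul_comm Λ (v 0 : ℝ),
          ← div_le_iff₀ hΛ0]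
        exact ⟨(a 0).2, (a 0).1⟩
      have hq' := (rpow_mem_Icc_inv α hΛ hq).2
      rw [Real.div_rpow hM0.le h0.le, div_le_iff₀ (by positivity)] at hq'
      rw [e, abs_div, abs_of_pos (Real.rpow_pos_of_pos h0 α), div_le_iff₀ (by positivity)]
      refine b.trans ?_
      have e3 : M ^ (α - 2) = M ^ α / M ^ 2 := by
        rw [Real.rpow_sub hM0, Real.rpow_two]
      rw [e3]
      calc c * (M ^ α / M ^ 2) ≤ c * (Λ ^ |α| * (v 0 : ℝ) ^ α / (R * J) ^ 2) := by gcongr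
        _ = c * Λ ^ |α| / (R * J) ^ 2 * (v 0 : ℝ) ^ α := by ring

theorem energyBound_two (σ : Fin 4 → ℤ) (α : ℝ) : EnergyBound σ α 2 := by
  intro Λ c hΛ hc
  refine ⟨(Λ + 1) ^ 4, one_le_pow₀ (by linarith), fun M hM s hs => ?_⟩
  have hM0 : 0 < M := by linarith
  have hΛ0 : 0 < Λ := by linarith
  have hsub : s ⊆ Fintype.piFinset (fun _ : Fin 4 => Finset.Icc (1 : ℤ) ⌊Λ * M⌋) := by
    intro v hv
    rw [Fintype.mem_piFinset]
    intro i
    obtain ⟨a, b⟩ := (hs v hv).1 i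
    have : (0 : ℝ) < v i := lt_of_lt_of_le (by positivity) a
    rw [Finset.mem_Icc]
    exact ⟨by exact_mod_cast this, Int.le_floor.2 b⟩
  have h1 := Finset.card_le_card hsub
  rw [Fintype.card_piFinset_const, Int.card_Icc, add_sub_cancel_right] at h1
  have h2 : ((⌊Λ * M⌋.toNat : ℕ) : ℝ) ≤ (Λ + 1) * M := by
    have e : ((⌊Λ * M⌋.toNat : ℕ) : ℝ) = ((⌊Λ * M⌋ : ℤ) : ℝ) := by
      exact_mod_cast congrArg (Int.cast : ℤ → ℝ)
        (Int.toNat_of_nonneg (Int.floor_nonneg.2 (by positivity)))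
    rw [e]
    have := Int.floor_le (Λ * M)
    linarith
  calc (#s : ℝ) ≤ ((⌊Λ * M⌋.toNat : ℕ) : ℝ) ^ 4 := by exact_mod_cast h1
    _ ≤ ((Λ + 1) * M) ^ 4 := by gcongr
    _ = (Λ + 1) ^ 4 * M ^ ((2 : ℝ) + 2) := by
      rw [mul_pow]; norm_num

theorem energyBound_of_pos {σ : Fin 4 → ℤ} (hσ : ∀ i, σ i = 1 ∨ σ i = -1)
    (hσ0 : σ 0 = 1) {α ε : ℝ} (hα : α ≠ 0) (hα1 : α ≠ 1) (hε : 0 < ε) : EnergyBound σ α ε := by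
  have key : ∀ n : ℕ, ∀ α : ℝ, α ≠ 0 → α ≠ 1 → EnergyBound σ α (2 / (2 * n + 1)) := by
    intro n
    induction n with
    | zero => intro α _ _; simpa using energyBound_two σ α
    | succ n ih =>
      intro α hα hα1
      have hα1' : α - 1 ≠ 0 := sub_ne_zero.2 hα1
      have := (ih (α / (α - 1)) (div_ne_zero hα hα1') (by
        rw [Ne, div_eq_one_iff_eq hα1']; intro h; linarith)).of_dual hσ hσ0 hα hα1 (by positivity)
      convert this using 1
      push_cast
      field_simp
      ring
  obtain ⟨n, hn⟩ := exists_nat_gt (2 / ε)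
  intro Λ c hΛ hc
  obtain ⟨C, hC, h⟩ := key n α hα hα1 Λ c hΛ hc
  refine ⟨C, hC, fun M hM s hs => (h M hM s hs).trans ?_⟩
  gcongr
  rw [div_lt_iff₀ hε] at hn
  rw [div_le_iff₀ (by positivity)]
  nlinarith

theorem bounds_of_mem_Ioc_floor {M : ℝ} (hM : 0 ≤ M) {m : ℕ} (hm : m ∈ Ioc ⌊M⌋₊ ⌊2 * M⌋₊) :
    M < m ∧ (m : ℝ) ≤ 2 * M := by
  rw [Finset.mem_Ioc] at hm
  exact ⟨(Nat.floor_lt hM).1 hm.1, (Nat.le_floor_iff (by positivity)).1 hm.2⟩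

/-- The number of `(a, b, c, d)` in the dyadic range `(M, 2M]` with
`|(a^α - b^α) - (c^α - d^α)| ≤ δ`. -/
noncomputable def powEnergy (α M δ : ℝ) : ℕ :=
  closePairs (Ioc ⌊M⌋₊ ⌊2 * M⌋₊ ×ˢ Ioc ⌊M⌋₊ ⌊2 * M⌋₊) (Ioc ⌊M⌋₊ ⌊2 * M⌋₊ ×ˢ Ioc ⌊M⌋₊ ⌊2 * M⌋₊)
    (fun p : ℕ × ℕ => (p.1 : ℝ) ^ α - (p.2 : ℝ) ^ α)
    (fun p : ℕ × ℕ => (p.1 : ℝ) ^ α - (p.2 : ℝ) ^ α) δ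

theorem exists_powEnergy_le {α ε : ℝ} (hα : α ≠ 0) (hα1 : α ≠ 1) (hε : 0 < ε) :
    ∃ C : ℝ, 1 ≤ C ∧ ∀ M : ℝ, 1 ≤ M → (powEnergy α M (M ^ (α - 2)) : ℝ) ≤ C * M ^ (2 + ε) := by
  classical
  have hσ : ∀ i : Fin 4, (![1, -1, -1, 1] : Fin 4 → ℤ) i = 1 ∨
      (![1, -1, -1, 1] : Fin 4 → ℤ) i = -1 := by decide
  obtain ⟨C, hC, h⟩ := energyBound_of_pos (ε := ε) hσ rfl hα hα1 hε 2 1 one_le_two zero_le_one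
  refine ⟨C, hC, fun M hM => ?_⟩
  have hM0 : 0 < M := by linarith
  set g : (ℕ × ℕ) × (ℕ × ℕ) → (Fin 4 → ℤ) := fun t => ![t.1.1, t.1.2, t.2.1, t.2.2] with hg
  have hginj : Function.Injective g := by
    rintro ⟨⟨a, b⟩, c, d⟩ ⟨⟨a', b'⟩, c', d'⟩ h
    have e0 := congrFun h 0
    have e1 := congrFun h 1
    have e2 := congrFun h 2
    have e3 := congrFun h 3
    simp only [hg, Matrix.cons_val] at e0 e1 e2 e3
    norm_cast at e0 e1 e2 e3
    subst e0 e1 e2 e3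
    rfl
  rw [powEnergy, closePairs, ← Finset.card_image_of_injective _ hginj]
  refine h M hM _ fun v hv => ?_
  obtain ⟨⟨⟨a, b⟩, c, d⟩, ht, rfl⟩ := Finset.mem_image.1 hv
  simp only [Finset.mem_filter, Finset.mem_product] at ht
  obtain ⟨⟨⟨ha, hb⟩, hc, hd⟩, hF⟩ := ht
  have key : ∀ m : ℕ, m ∈ Ioc ⌊M⌋₊ ⌊2 * M⌋₊ → M / 2 ≤ ((m : ℤ) : ℝ) ∧ ((m : ℤ) : ℝ) ≤ 2 * M := by
    intro m hm
    have := bounds_of_mem_Ioc_floor hM0.le hm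
    rw [Int.cast_natCast]
    exact ⟨by linarith, this.2⟩
  refine ⟨fun i => ?_, ?_⟩
  · fin_cases i
    · exact key a ha
    · exact key b hb
    · exact key c hc
    · exact key d hd
  · rw [one_mul]
    refine le_trans (le_of_eq ?_) hF
    rw [Fin.sum_univ_four]
    congr 1
    simp [hg]
    ring

theorem exists_sqrt_powEnergy_le {α ε : ℝ} (hα : α ≠ 0) (hα1 : α ≠ 1) (hε : 0 < ε) :
    ∃ C : ℝ, 1 ≤ C ∧ ∀ M δ : ℝ, 1 ≤ M → 0 ≤ δ → √(powEnergy α M δ : ℝ) ≤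
      C * (M ^ (1 + ε) + M ^ (2 - α / 2 + ε) * √δ) := by
  obtain ⟨C, hC, h⟩ := exists_powEnergy_le hα hα1 (ε := 2 * ε) (by positivity)
  refine ⟨3 * C, by linarith, fun M δ hM hδ => ?_⟩
  have hM0 : 0 < M := by linarith
  set δ₀ := M ^ (α - 2) with hδ₀
  have hδ₀0 : 0 < δ₀ := by positivity
  set u := M ^ (1 + ε) with hu
  set w := M ^ (2 - α / 2 + ε) * √δ with hw
  have hu0 : 0 ≤ u := by positivity
  have hw0 : 0 ≤ w := by positivity
  have hsq : ∀ x : ℝ, (M ^ x) ^ 2 = M ^ (x * 2) := fun x => by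
    rw [← Real.rpow_two, ← Real.rpow_mul hM0.le]
  have hu2 : u ^ 2 = M ^ (2 + 2 * ε) := by rw [hu, hsq]; congr 1; ring
  have hw2 : w ^ 2 = δ / δ₀ * M ^ (2 + 2 * ε) := by
    rw [hw, mul_pow, Real.sq_sqrt hδ, hsq, hδ₀, div_mul_eq_mul_div, mul_div_assoc,
      ← Real.rpow_sub hM0, mul_comm]
    congr 2; ring
  have h1 : (powEnergy α M δ : ℝ) ≤ (2 * δ / δ₀ + 3) * powEnergy α M δ₀ := by
    have := closePairs_le_sqrt (Ioc ⌊M⌋₊ ⌊2 * M⌋₊ ×ˢ Ioc ⌊M⌋₊ ⌊2 * M⌋₊)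
      (Ioc ⌊M⌋₊ ⌊2 * M⌋₊ ×ˢ Ioc ⌊M⌋₊ ⌊2 * M⌋₊)
      (fun p : ℕ × ℕ => (p.1 : ℝ) ^ α - (p.2 : ℝ) ^ α)
      (fun p : ℕ × ℕ => (p.1 : ℝ) ^ α - (p.2 : ℝ) ^ α) hδ hδ₀0
    rwa [Real.sqrt_mul_self (Nat.cast_nonneg _)] at this
  refine Real.sqrt_le_iff.2 ⟨by positivity, ?_⟩
  calc (powEnergy α M δ : ℝ) ≤ (2 * δ / δ₀ + 3) * (C * M ^ (2 + 2 * ε)) :=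
        h1.trans (mul_le_mul_of_nonneg_left (h M hM) (by positivity))
    _ = C * (3 * u ^ 2 + 2 * w ^ 2) := by rw [hu2, hw2]; ring
    _ ≤ C ^ 2 * (3 * u ^ 2 + 2 * w ^ 2) := by
        gcongr
        exact le_self_pow₀ hC two_ne_zero
    _ ≤ C ^ 2 * (9 * (u + w) ^ 2) := by
        gcongr
        nlinarith [mul_nonneg hu0 hw0, sq_nonneg u, sq_nonneg w]
    _ = (3 * C * (u + w)) ^ 2 := by ring

theorem closePairs_scaled_le {α M₁ M₂ H Δ x : ℝ} (hH : 0 < H) (hx : H ≤ x) (hΔ : 0 < Δ) :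
    (closePairs (Ioc ⌊M₁⌋₊ ⌊2 * M₁⌋₊ ×ˢ Ioc ⌊M₂⌋₊ ⌊2 * M₂⌋₊)
      (Ioc ⌊M₁⌋₊ ⌊2 * M₁⌋₊ ×ˢ Ioc ⌊M₂⌋₊ ⌊2 * M₂⌋₊)
      (fun p : ℕ × ℕ => ((p.1 : ℝ) ^ α - (p.2 : ℝ) ^ α) * x)
      (fun p : ℕ × ℕ => ((p.1 : ℝ) ^ α - (p.2 : ℝ) ^ α) * x) Δ : ℝ) ≤
      5 * (√(powEnergy α M₁ (Δ / H)) * √(powEnergy α M₂ (Δ / H))) := by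
  classical
  have hδ : 0 < Δ / H := by positivity
  have hx0 : 0 < x := hH.trans_le hx
  have h1 := closePairs_le_sqrt (Ioc ⌊M₁⌋₊ ⌊2 * M₁⌋₊ ×ˢ Ioc ⌊M₁⌋₊ ⌊2 * M₁⌋₊)
    (Ioc ⌊M₂⌋₊ ⌊2 * M₂⌋₊ ×ˢ Ioc ⌊M₂⌋₊ ⌊2 * M₂⌋₊)
    (fun p : ℕ × ℕ => (p.1 : ℝ) ^ α - (p.2 : ℝ) ^ α)
    (fun p : ℕ × ℕ => (p.1 : ℝ) ^ α - (p.2 : ℝ) ^ α) hδ.le hδ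
  rw [mul_div_assoc, div_self hδ.ne', Real.sqrt_mul (Nat.cast_nonneg _)] at h1
  norm_num at h1
  refine le_trans ?_ h1
  rw [Nat.cast_le, closePairs, closePairs]
  refine Finset.card_le_card_of_injOn
    (fun t : (ℕ × ℕ) × (ℕ × ℕ) => ((t.1.1, t.2.1), (t.1.2, t.2.2))) ?_ ?_
  · rintro ⟨⟨a, b⟩, c, d⟩ ht
    simp only [Finset.coe_filter, Finset.mem_product, Set.mem_ofPred_eq] at ht ⊢
    obtain ⟨⟨⟨ha, hb⟩, hc, hd⟩, hF⟩ := ht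
    refine ⟨⟨⟨ha, hc⟩, hb, hd⟩, ?_⟩
    rw [← sub_mul, abs_mul, abs_of_pos hx0, ← le_div_iff₀ hx0] at hF
    calc |(a : ℝ) ^ α - (c : ℝ) ^ α - ((b : ℝ) ^ α - (d : ℝ) ^ α)|
        = |(a : ℝ) ^ α - (b : ℝ) ^ α - ((c : ℝ) ^ α - (d : ℝ) ^ α)| := by congr 1; ring
      _ ≤ Δ / x := hF
      _ ≤ Δ / H := by gcongr
  · rintro ⟨⟨a, b⟩, c, d⟩ _ ⟨⟨a', b'⟩, c', d'⟩ _ h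
    simp only [Prod.mk.injEq] at h ⊢
    tauto

theorem Bcount_le_sqrt {α β M₁ M₂ H Δ : ℝ} (hβ : 0 ≤ β) (hH : 1 ≤ H) (hΔ : 0 < Δ) :
    (Bcount α β M₁ M₂ H Δ : ℝ) ≤
      100 * H ^ 2 * (√(powEnergy α M₁ (Δ / H ^ β)) * √(powEnergy α M₂ (Δ / H ^ β))) := by
  classical
  have hH0 : 0 < H := by linarith
  set E := √(powEnergy α M₁ (Δ / H ^ β)) * √(powEnergy α M₂ (Δ / H ^ β)) with hE
  have hE0 : 0 ≤ E := by positivity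
  set T := Ioc ⌊M₁⌋₊ ⌊2 * M₁⌋₊ ×ˢ Ioc ⌊M₂⌋₊ ⌊2 * M₂⌋₊ with hT
  set I := Ioc ⌊H⌋₊ ⌊2 * H⌋₊ with hI
  set F : ℕ → ℕ × ℕ → ℝ := fun n p => ((p.1 : ℝ) ^ α - (p.2 : ℝ) ^ α) * (n : ℝ) ^ β with hF
  have hfix : ∀ q ∈ I ×ˢ I, (closePairs T T (F q.1) (F q.2) Δ : ℝ) ≤ 25 * E := by
    intro q hq
    rw [Finset.mem_product] at hq
    have hpow : ∀ n ∈ I, H ^ β ≤ (n : ℝ) ^ β := fun n hn =>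
      Real.rpow_le_rpow hH0.le (bounds_of_mem_Ioc_floor hH0.le hn).1.le hβ
    have b1 : (closePairs T T (F q.1) (F q.1) Δ : ℝ) ≤ 5 * E :=
      closePairs_scaled_le (by positivity) (hpow _ hq.1) hΔ
    have b2 : (closePairs T T (F q.2) (F q.2) Δ : ℝ) ≤ 5 * E :=
      closePairs_scaled_le (by positivity) (hpow _ hq.2) hΔ
    have h1 := closePairs_le_sqrt T T (F q.1) (F q.2) hΔ.le hΔ
    have h2 : √((closePairs T T (F q.1) (F q.1) Δ : ℝ) * closePairs T T (F q.2) (F q.2) Δ) ≤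
        5 * E := by
      rw [← Real.sqrt_mul_self (show 0 ≤ 5 * E by positivity)]
      exact Real.sqrt_le_sqrt (by gcongr)
    rw [mul_div_assoc, div_self hΔ.ne'] at h1
    linarith
  have hIcard : (#I : ℝ) ≤ 2 * H := by
    rw [hI, Nat.card_Ioc]
    have : ((⌊2 * H⌋₊ - ⌊H⌋₊ : ℕ) : ℝ) ≤ ⌊2 * H⌋₊ := by exact_mod_cast Nat.sub_le _ _
    exact this.trans (Nat.floor_le (by positivity))
  have hsum : Bcount α β M₁ M₂ H Δ ≤ ∑ q ∈ I ×ˢ I, closePairs T T (F q.1) (F q.2) Δ := by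
    rw [Bcount, Finset.card_eq_sum_card_fiberwise (t := I ×ˢ I)
      (f := fun t : ℕ × ℕ × ℕ × ℕ × ℕ × ℕ => t.2.2.2.2)]
    · refine Finset.sum_le_sum fun q _ => ?_
      refine Finset.card_le_card_of_injOn (fun t => ((t.1, t.2.2.1), (t.2.1, t.2.2.2.1))) ?_ ?_
      · rintro ⟨a, b, c, d, n, n'⟩ ht
        simp only [Finset.coe_filter, Finset.mem_filter, Finset.mem_product,
          Set.mem_ofPred_eq] at ht ⊢
        obtain ⟨⟨⟨ha, hb, hc, hd, -⟩, -, -, hle⟩, rfl⟩ := ht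
        exact ⟨⟨Finset.mem_product.2 ⟨ha, hc⟩, Finset.mem_product.2 ⟨hb, hd⟩⟩, hle⟩
      · rintro ⟨a, b, c, d, n⟩ h ⟨a', b', c', d', n'⟩ h' hh
        simp only [Finset.coe_filter, Finset.mem_filter, Set.mem_ofPred_eq] at h h'
        simp only [Prod.mk.injEq] at hh ⊢
        have := h.2.trans h'.2.symm
        tauto
    · rintro ⟨a, b, c, d, n⟩ ht
      simp only [Finset.coe_filter, Finset.mem_product, Set.mem_ofPred_eq] at ht
      exact Finset.mem_product.2 ht.1.2.2.2.2
  calc (Bcount α β M₁ M₂ H Δ : ℝ)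
      ≤ ∑ q ∈ I ×ˢ I, (closePairs T T (F q.1) (F q.2) Δ : ℝ) := by exact_mod_cast hsum
    _ ≤ #(I ×ˢ I) • (25 * E) := Finset.sum_le_card_nsmul _ _ _ hfix
    _ = #I * #I * (25 * E) := by rw [nsmul_eq_mul, Finset.card_product]; push_cast; ring
    _ ≤ (2 * H) * (2 * H) * (25 * E) := by gcongr
    _ = 100 * H ^ 2 * E := by ring

theorem spacing_count_m_aspect (α β : ℝ)
    (hα0 : 0 < α) (hα1 : α < 1) (hβ0 : 0 < β) (hβ1 : β < 1)
    (ε : ℝ) (hε : 0 < ε) :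
    ∃ C : ℝ, 0 < C ∧ ∀ M₁ M₂ H Δ : ℝ, 2 ≤ M₁ → 2 ≤ M₂ → 1 ≤ H → 0 < Δ →
      (Bcount α β M₁ M₂ H Δ : ℝ)
        ≤ C * ((H * M₁^(1 + ε) + M₁^(2 - α/2 + ε) * Δ^((1:ℝ)/2) * H^(1 - β/2))
             * (H * M₂^(1 + ε) + M₂^(2 - α/2 + ε) * Δ^((1:ℝ)/2) * H^(1 - β/2))) := by
  obtain ⟨C, hC, h⟩ := exists_sqrt_powEnergy_le hα0.ne' hα1.ne hε
  refine ⟨100 * C ^ 2, by positivity, fun M₁ M₂ H Δ hM₁ hM₂ hH hΔ => ?_⟩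
  have hH0 : 0 < H := by linarith
  have hsqrt : √(Δ / H ^ β) = Δ ^ ((1 : ℝ) / 2) * H ^ (-(β / 2)) := by
    rw [Real.sqrt_eq_rpow, Real.div_rpow hΔ.le (by positivity), ← Real.rpow_mul hH0.le,
      Real.rpow_neg hH0.le, div_eq_mul_inv]
    congr 3; ring
  have hHβ : H ^ (1 - β / 2) = H * H ^ (-(β / 2)) := by
    rw [sub_eq_add_neg, Real.rpow_add hH0, Real.rpow_one]
  have b₁ := h M₁ (Δ / H ^ β) (by linarith) (by positivity)
  have b₂ := h M₂ (Δ / H ^ β) (by linarith) (by positivity)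
  rw [hsqrt] at b₁ b₂
  refine (Bcount_le_sqrt hβ0.le hH hΔ).trans ?_
  have hM₁0 : 0 < M₁ := by linarith
  have hM₂0 : 0 < M₂ := by linarith
  refine (mul_le_mul_of_nonneg_left (mul_le_mul b₁ b₂ (Real.sqrt_nonneg _) (by positivity))
    (by positivity)).trans (le_of_eq ?_)
  rw [hHβ]
  ring
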